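/- Consider a B₀ T²-symmetric Einstein flow, and suppose the corrected energy H is positive on [s₀, s]. Then for s ≥ s₀ one has |(c, d)|(s) ≲ e^{(s₀−s)/4} ( e^{s₀} H(s₀) / (e^{s} H(s)) )^{1/2} |(c, d)|(s₀) + ∫_{s₀}^{s} e^{(τ−s)/4} ( e^{τ} H(τ) / (e^{s} H(s)) )^{1/2} |Ω̃(τ)| dτ, where |(c,d)| denotes the Euclidean norm of the vector (c, d). -/

import Mathlib

noncomputable section

open Real MeasureTheory intervalIntegral

/-- The θ-mean of a function on the circle of circumference 1 (total measure 1). -/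
def circleMean (f : ℝ → ℝ) : ℝ := ∫ θ in (0:ℝ)..1, f θ

/-- The smooth, θ-periodic fields `V, Q, ρ, l` of a T²-symmetric spacetime in areal
coordinates; first argument is `τ`, second is `θ`. -/
structure T2Flow where
  V : ℝ → ℝ → ℝ
  Q : ℝ → ℝ → ℝ
  ρ : ℝ → ℝ → ℝ
  l : ℝ → ℝ → ℝ
  smooth_V : ContDiff ℝ (⊤ : ℕ∞) (Function.uncurry V)
  smooth_Q : ContDiff ℝ (⊤ : ℕ∞) (Function.uncurry Q)
  smooth_ρ : ContDiff ℝ (⊤ : ℕ∞) (Function.uncurry ρ)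
  smooth_l : ContDiff ℝ (⊤ : ℕ∞) (Function.uncurry l)
  periodic_V : ∀ τ, Function.Periodic (V τ) 1
  periodic_Q : ∀ τ, Function.Periodic (Q τ) 1
  periodic_ρ : ∀ τ, Function.Periodic (ρ τ) 1
  periodic_l : ∀ τ, Function.Periodic (l τ) 1

namespace T2Flow

/-- `V_τ`. -/
def Vτ (F : T2Flow) (τ θ : ℝ) : ℝ := deriv (fun s => F.V s θ) τ
/-- `V_θ`. -/
def Vθ (F : T2Flow) (τ θ : ℝ) : ℝ := deriv (fun x => F.V τ x) θ
/-- `Q_τ`. -/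
def Qτ (F : T2Flow) (τ θ : ℝ) : ℝ := deriv (fun s => F.Q s θ) τ
/-- `Q_θ`. -/
def Qθ (F : T2Flow) (τ θ : ℝ) : ℝ := deriv (fun x => F.Q τ x) θ
/-- `ρ_τ`. -/
def ρτ (F : T2Flow) (τ θ : ℝ) : ℝ := deriv (fun s => F.ρ s θ) τ
/-- `l_τ`. -/
def lτ (F : T2Flow) (τ θ : ℝ) : ℝ := deriv (fun s => F.l s θ) τ
/-- `l_θ`. -/
def lθ (F : T2Flow) (τ θ : ℝ) : ℝ := deriv (fun x => F.l τ x) θ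

/-- The energy density
`J = (1/2)[V_τ² + e^{2(τ−ρ)}V_θ² + e^{2(V−τ)}(Q_τ² + e^{2(τ−ρ)}Q_θ²)]`. -/
def J (F : T2Flow) (τ θ : ℝ) : ℝ :=
  (1/2) * (F.Vτ τ θ ^ 2 + exp (2*(τ - F.ρ τ θ)) * F.Vθ τ θ ^ 2
    + exp (2*(F.V τ θ - τ)) * (F.Qτ τ θ ^ 2 + exp (2*(τ - F.ρ τ θ)) * F.Qθ τ θ ^ 2))

/-- The T²-symmetric vacuum Einstein evolution equations together with the
momentum constraint. -/
def IsEinsteinFlow (F : T2Flow) : Prop :=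
  (∀ τ θ : ℝ, deriv (fun s => exp (F.ρ s θ) * F.Vτ s θ) τ
      = deriv (fun x => exp (2*τ - F.ρ τ x) * F.Vθ τ x) θ
        + exp (2*(F.V τ θ - τ) + F.ρ τ θ)
          * (F.Qτ τ θ ^ 2 - exp (2*(τ - F.ρ τ θ)) * F.Qθ τ θ ^ 2)) ∧
  (∀ τ θ : ℝ, deriv (fun s => exp (F.ρ s θ + 2*(F.V s θ - s)) * F.Qτ s θ) τ
      = deriv (fun x => exp (-F.ρ τ x + 2*F.V τ x) * F.Qθ τ x) θ) ∧
  (∀ τ θ : ℝ, F.lτ τ θ + F.ρτ τ θ + 2 = F.J τ θ) ∧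
  (∀ τ θ : ℝ, F.ρτ τ θ = exp (F.l τ θ)) ∧
  (∀ τ θ : ℝ, F.lθ τ θ = F.Vθ τ θ * F.Vτ τ θ
      + exp (2*(F.V τ θ - τ)) * F.Qθ τ θ * F.Qτ τ θ)

/-- The conserved quantity `A = ∫ e^ρ (V_τ − e^{2(V−τ)} Q_τ Q) dθ`. -/
def A (F : T2Flow) (τ : ℝ) : ℝ :=
  ∫ θ in (0:ℝ)..1,
    exp (F.ρ τ θ) * (F.Vτ τ θ - exp (2*(F.V τ θ - τ)) * F.Qτ τ θ * F.Q τ θ)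

/-- The conserved quantity `B = ∫ e^{ρ+2(V−τ)} Q_τ dθ`. -/
def B (F : T2Flow) (τ : ℝ) : ℝ :=
  ∫ θ in (0:ℝ)..1, exp (F.ρ τ θ + 2*(F.V τ θ - τ)) * F.Qτ τ θ

/-- The energy `E = ∫ e^{ρ−2τ} J dθ`. -/
def E (F : T2Flow) (τ : ℝ) : ℝ := ∫ θ in (0:ℝ)..1, exp (F.ρ τ θ - 2*τ) * F.J τ θ

/-- The `S¹`-volume `Π = ⟨e^ρ⟩`. -/
def Pi (F : T2Flow) (τ : ℝ) : ℝ := ∫ θ in (0:ℝ)..1, exp (F.ρ τ θ)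

/-- The correction `Λ = (1/2) e^{−2τ} ∫ V_τ (V − ⟨V⟩ − 1) e^ρ dθ`. -/
def Λ (F : T2Flow) (τ : ℝ) : ℝ :=
  (1/2) * exp (-2*τ) *
    ∫ θ in (0:ℝ)..1, F.Vτ τ θ * (F.V τ θ - circleMean (F.V τ) - 1) * exp (F.ρ τ θ)

/-- The corrected, normalized energy `H = Π (E + Λ)`. -/
def H (F : T2Flow) (τ : ℝ) : ℝ := F.Pi τ * (F.E τ + F.Λ τ)

/-- The twist potential `Y = ⟨e^{l+ρ+2τ}⟩`. -/
def Y (F : T2Flow) (τ : ℝ) : ℝ := ∫ θ in (0:ℝ)..1, exp (F.l τ θ + F.ρ τ θ + 2*τ)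

/-- The error term `Ω = ⟨e^{l+ρ+2τ} J⟩ − e^{2τ} E Y Π⁻¹`. -/
def Ω (F : T2Flow) (τ : ℝ) : ℝ :=
  (∫ θ in (0:ℝ)..1, exp (F.l τ θ + F.ρ τ θ + 2*τ) * F.J τ θ)
    - exp (2*τ) * F.E τ * F.Y τ / F.Pi τ

end T2Flow

namespace T2Flow

/-- The normalized quantity `c = Π/(e^τ √H) − 2/√10`. -/
def c (F : T2Flow) (τ : ℝ) : ℝ :=
  F.Pi τ / (Real.exp τ * Real.sqrt (F.H τ)) - 2 / Real.sqrt 10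

/-- The normalized quantity `d = Y/(e^{3τ} √H) − 1/√10`. -/
def d (F : T2Flow) (τ : ℝ) : ℝ :=
  F.Y τ / (Real.exp (3*τ) * Real.sqrt (F.H τ)) - 1 / Real.sqrt 10

end T2Flow

/-- The quadratic nonlinearity `f(c,d) = ((10c − 10d + 3√10)/4)c² − √10 c d`. -/
def fquad (c d : ℝ) : ℝ :=
  ((10*c - 10*d + 3*Real.sqrt 10) / 4) * c ^ 2 - Real.sqrt 10 * (c * d)

namespace T2Flow

/-- The error vector `Ω̃` of the linearized `(c,d)` system. -/
def Ωtilde (F : T2Flow) (τ : ℝ) : ℝ × ℝ :=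
  (-(1/2) * deriv (fun s => Real.log (Real.exp s * F.H s)) τ * (2 / Real.sqrt 10),
   -(1/2) * deriv (fun s => Real.log (Real.exp s * F.H s)) τ * (1 / Real.sqrt 10)
     + fquad (F.d τ) (F.c τ) / (F.c τ + 2 / Real.sqrt 10) ^ 2
     + (F.Pi τ * F.E τ / F.H τ - 1) * (F.d τ + 1 / Real.sqrt 10)
         / (F.c τ + 2 / Real.sqrt 10) ^ 2
     + F.Ω τ / (Real.exp (3*τ) * Real.sqrt (F.H τ)))

end T2Flow

theorem decay_polynomial_nonneg {x y : ℝ} (hx : -2 < x) (hy : -1 < y) (h : 1 ≤ x + 4/5*y) :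
    0 ≤ 2*(y^3+(3-x)*y^2+x^2*y+x^2+4*x)+(x/2-y)*(x+2)^2 - 1/4*(x+4/5*y)*(x+2)^2 := by
  obtain ⟨p, rfl⟩ : ∃ p, x = p - 2 := ⟨x+2, by ring⟩
  obtain ⟨r, rfl⟩ : ∃ r, y = r - 1 := ⟨y+1, by ring⟩
  have hp : 0 < p := by linarith
  have hr : 0 < r := by linarith
  nlinarith [mul_pos hp hr, mul_nonneg hp.le (sq_nonneg (p-2*r)), mul_nonneg hr.le (sq_nonneg (p-r)), mul_nonneg hp.le (sq_nonneg (p-r)),mul_nonneg hr.le (sq_nonneg (p-2*r)), mul_nonneg (sub_nonneg.2 h) (sq_nonneg p), mul_nonneg (sub_nonneg.2 h) (sq_nonneg r), mul_nonneg (sub_nonneg.2 h) (sq_nonneg (p-r)), mul_nonneg (sub_nonneg.2 h) hp.le, mul_nonneg (sub_nonneg.2 h) hr.le]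

theorem binary_quadratic_pos {a b c x q : ℝ} (ha : 0 < a) (hd : b^2 < 4*a*c) (h : x ≠ 0 ∨ q ≠ 0) :
    0 < a*q^2 + b*(q*x) + c*x^2 := by
  have key : 4*a*(a*q^2 + b*(q*x) + c*x^2) = (2*a*q+b*x)^2 + (4*a*c-b^2)*x^2 := by ring
  have : 0 < 4*a*(a*q^2 + b*(q*x) + c*x^2) := by
    rw [key]
    rcases eq_or_ne x 0 with rfl | hx
    · have hq : q ≠ 0 := by simpa using h
      have : 2*a*q ≠ 0 := by positivity
      simp; positivity
    · have := mul_pos (sub_pos.2 hd) (by positivity : 0 < x^2)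
      positivity
  exact pos_of_mul_pos_right this (by positivity)

theorem decay_quartic_pos {x q : ℝ} (hx : -2 < x) (h : x ≠ 0 ∨ q ≠ 0) :
    0 < 5/2*q^4 - (1/2+5/8*x)*q^3 + (1+27/4*x+63/32*x^2)*q^2 + x^2*(57/128*x^2+87/32*x+39/4)/4 := by
  have key : ∀ m : ℝ, 0 < 1+27/4*x+63/32*x^2 - 5/2*(1/10+x/8)^2 - 5*m*x →
      (5*m*(1/10+x/8))^2 < 4*(1+27/4*x+63/32*x^2 - 5/2*(1/10+x/8)^2 - 5*m*x)*
        ((57/128*x^2+87/32*x+39/4)/4-5/2*m^2) →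
      0 < 5/2*q^4 - (1/2+5/8*x)*q^3 + (1+27/4*x+63/32*x^2)*q^2
        + x^2*(57/128*x^2+87/32*x+39/4)/4 := by
    intro m h1 h2
    have := binary_quadratic_pos h1 h2 h
    nlinarith [sq_nonneg (q*(q-(1/10+x/8))+m*x)]
  rcases lt_or_ge x 0 with hx0 | hx0
  · rcases lt_or_ge x (-13/10) with h1 | h1
    · apply key (7/10)
      · nlinarith [mul_pos (neg_pos.2 hx0) (sub_pos.2 h1)]
      · have h2 : 0 < x + 2 := by linarith
        have h3 : 0 < -13/10 - x := by linarith
        have h4 := mul_pos h2 h3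
        nlinarith [mul_pos h4 h4, mul_pos h4 h2, mul_pos h4 h3]
    · apply key (81/100)
      · nlinarith [sq_nonneg (x+7/10)]
      · have h2 : 0 < -x := by linarith
        have h3 : 0 ≤ x+13/10 := by linarith
        have h4 := mul_nonneg h2.le h3
        nlinarith [mul_nonneg h4 (sq_nonneg (x+7/10)),  mul_nonneg h4 h2.le, mul_nonneg h4 h3, sq_nonneg (x*(x+7/10)),sq_nonneg ((x+7/10)), sq_nonneg ((x+7/10)*(x+1))]
  · apply key 0
    · nlinarith
    · have : 0 < 1+27/4*x+63/32*x^2 - 5/2*(1/10+x/8)^2 - 5*0*x := by nlinarith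
      have h4: 0 < (57/128*x^2+87/32*x+39/4)/4-5/2*(0:ℝ)^2 := by nlinarith
      have := mul_pos this h4
      nlinarith

/-- The first component of the rescaled autonomous field. -/
def fieldX (x y : ℝ) : ℝ := y - x/2

/-- The second component of the rescaled autonomous field. -/
def fieldY (x y : ℝ) : ℝ := -(5/2)*(y^3+(3-x)*y^2+x^2*y+x^2+4*x)/(x+2)^2

theorem linear_decay {x y : ℝ} (hx : -2 < x) (hy : -1 < y) (h : 1 ≤ x + 4/5*y) :
    fieldX x y + 4/5*fieldY x y ≤ -(x+4/5*y)/4 := by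
  have h1 := decay_polynomial_nonneg hx hy h
  have hp : 0 < (x+2)^2 := by have : 0 < x+2 := by linarith
                              positivity
  have : -(x+4/5*y)/4 - (fieldX x y + 4/5*fieldY x y) =
    (2*(y^3+(3-x)*y^2+x^2*y+x^2+4*x)+(x/2-y)*(x+2)^2 - 1/4*(x+4/5*y)*(x+2)^2)/(x+2)^2 := by
    have hp' : x + 2 ≠ 0 := by linarith
    unfold fieldX fieldY; field_simp; ring
  have := this ▸ div_nonneg h1 hp.le
  linarith

/-- The exponential weight of the mid-range Lyapunov function. -/
def weight (x : ℝ) : ℝ := Real.exp (-16/(x+2))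

/-- The derivative of `potW`, divided by the weight. -/
def potSlope (x : ℝ) : ℝ := x*(57/128*x^2+87/32*x+39/4)/(x+2)^2

/-- The potential part of the mid-range Lyapunov function. -/
def potW (x : ℝ) : ℝ := ∫ t in (0:ℝ)..x, weight t * potSlope t

/-- The mid-range Lyapunov function. -/
def potS (x y : ℝ) : ℝ := weight x * (y-x/4)^2/2 + potW x

/-- The partial derivative of `potS` in the first variable. -/
def potSx (x y : ℝ) : ℝ :=
  weight x*(16/(x+2)^2)*(y-x/4)^2/2 - weight x*(y-x/4)/4 + weight x*potSlope x

/-- The partial derivative of `potS` in the second variable. -/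
def potSy (x y : ℝ) : ℝ := weight x*(y-x/4)

theorem weight_pos (x : ℝ) : 0 < weight x := Real.exp_pos _

theorem weight_le_one {x : ℝ} (hx : -2 < x) : weight x ≤ 1 := by
  have : 0 < x + 2 := by linarith
  unfold weight
  rw [Real.exp_le_one_iff]
  exact div_nonpos_of_nonpos_of_nonneg (by norm_num) this.le

theorem weight_div_le_one {x : ℝ} (hx : -2 < x) : weight x / (x+2)^2 ≤ 1 := by
  have hp : 0 < x + 2 := by linarith
  have h1 : (16/(x+2)) + 1 ≤ Real.exp (16/(x+2)/2)^2 := by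
    rw [← Real.exp_nat_mul]
    have := Real.add_one_le_exp (((2:ℕ):ℝ)*(16/(x+2)/2))
    push_cast at this ⊢
    linarith
  have h2 : (16/(x+2)/2)^2 ≤ Real.exp (16/(x+2)) := by
    have := Real.add_one_le_exp (16/(x+2)/2)
    have h3 : 0 < 16/(x+2)/2 := by positivity
    have h4 : Real.exp (16/(x+2)) = Real.exp (16/(x+2)/2)^2 := by
      rw [← Real.exp_nat_mul]; congr 1; push_cast; ring
    rw [h4]
    gcongr; linarith
  unfold weight
  rw [div_le_one (by positivity), neg_div, Real.exp_neg, inv_le_comm₀ (Real.exp_pos _) (by positivity)]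
  refine le_trans ?_ h2
  rw [div_div, div_pow, inv_eq_one_div, mul_pow, div_le_div_iff₀ (by positivity) (by positivity)]
  nlinarith [sq_nonneg (x+2)]

theorem hasDerivAt_weight {x : ℝ} (hx : -2 < x) :
    HasDerivAt weight (weight x*(16/(x+2)^2)) x := by
  have hp : x + 2 ≠ 0 := by linarith
  have := (((hasDerivAt_id x).add_const (2:ℝ)).inv hp).const_mul (-16:ℝ)
  have := this.exp
  unfold weight
  simp only [div_eq_mul_inv] at *
  convert this using 1
  simp; ring_nf; simp

theorem continuousOn_weight_slope : ContinuousOn (fun t => weight t * potSlope t) (Set.Ioi (-2)) := by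
  intro t ht
  have hp : t + 2 ≠ 0 := by have : -2 < t := ht
                            linarith
  apply ContinuousAt.continuousWithinAt
  unfold weight potSlope
  fun_prop (disch := positivity)

theorem uIcc_subset {a b : ℝ} (ha : -2 < a) (hb : -2 < b) : Set.uIcc a b ⊆ Set.Ioi (-2) := by
  intro t ht
  exact lt_of_lt_of_le (lt_min ha hb) ht.1

theorem hasDerivAt_potW {x : ℝ} (hx : -2 < x) : HasDerivAt potW (weight x * potSlope x) x := by
  have hc := continuousOn_weight_slope
  refine integral_hasDerivAt_right
    (hc.mono (uIcc_subset (by norm_num) hx)).intervalIntegrable ?_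
    (hc.continuousAt (Ioi_mem_nhds hx))
  exact hc.stronglyMeasurableAtFilter isOpen_Ioi x hx

theorem slope_cubic_pos {x : ℝ} (hx : -2 < x) : 0 < 57/128*x^2+87/32*x+39/4 := by nlinarith

theorem potW_zero : potW 0 = 0 := by simp [potW]

theorem potW_anti {a b : ℝ} (ha : -2 < a) (hab : a < b) (hb : b ≤ 0) : potW b < potW a := by
  have : StrictAntiOn potW (Set.Icc a 0) := by
    refine strictAntiOn_of_deriv_neg (convex_Icc _ _) (fun x hx => ?_) (fun x hx => ?_)
    · exact (hasDerivAt_potW (lt_of_lt_of_le ha hx.1)).continuousAt.continuousWithinAt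
    · rw [interior_Icc] at hx
      have hx2 : -2 < x := ha.trans hx.1
      have hp : 0 < x + 2 := by linarith
      rw [(hasDerivAt_potW hx2).deriv]
      refine mul_neg_of_pos_of_neg (weight_pos x) ?_
      unfold potSlope
      exact div_neg_of_neg_of_pos (mul_neg_of_neg_of_pos hx.2 (slope_cubic_pos hx2)) (by positivity)
  exact this ⟨le_rfl, hab.le.trans hb⟩ ⟨hab.le, hb⟩ hab

theorem potW_pos {x : ℝ} (hx : -2 < x) (h : x ≠ 0) : 0 < potW x := by
  rcases lt_or_gt_of_ne h with h | h
  · simpa [potW_zero] using potW_anti hx h le_rfl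
  · have : StrictMonoOn potW (Set.Icc 0 x) := by
      refine strictMonoOn_of_deriv_pos (convex_Icc _ _) (fun t ht => ?_) (fun t ht => ?_)
      · exact (hasDerivAt_potW (lt_of_lt_of_le (by norm_num) ht.1)).continuousAt.continuousWithinAt
      · rw [interior_Icc] at ht
        have ht2 : -2 < t := lt_trans (by norm_num) ht.1
        have hp : 0 < t + 2 := by linarith
        rw [(hasDerivAt_potW ht2).deriv]
        refine mul_pos (weight_pos t) ?_
        unfold potSlope
        exact div_pos (mul_pos ht.1 (slope_cubic_pos ht2)) (by positivity)
    simpa [potW_zero] using this ⟨le_rfl, h.le⟩ ⟨h.le, le_rfl⟩ h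

theorem potW_nonneg {x : ℝ} (hx : -2 < x) : 0 ≤ potW x := by
  rcases eq_or_ne x 0 with rfl | h
  · rw [potW_zero]
  · exact (potW_pos hx h).le

theorem potS_nonneg {x : ℝ} (hx : -2 < x) (y : ℝ) : 0 ≤ potS x y := by
  have := potW_nonneg hx
  have := weight_pos x
  unfold potS; positivity

theorem potS_pos {x y : ℝ} (hx : -2 < x) (h : x ≠ 0 ∨ y ≠ 0) : 0 < potS x y := by
  have hM := weight_pos x
  unfold potS
  rcases eq_or_ne x 0 with rfl | h0
  · have hy : y ≠ 0 := by simpa using h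
    have : 0 < weight 0 * (y-0/4)^2/2 := by
      have : 0 < (y-0/4)^2 := by simp; positivity
      positivity
    rw [potW_zero]; linarith
  · have := potW_pos hx h0
    have : 0 ≤ weight x * (y-x/4)^2/2 := by positivity
    linarith

theorem potS_decay {x y : ℝ} (hx : -2 < x) (h : x ≠ 0 ∨ y ≠ 0) :
    potSx x y * fieldX x y + potSy x y * fieldY x y < 0 := by
  have hM := weight_pos x
  have hp : 0 < x+2 := by linarith
  have hxq : x ≠ 0 ∨ y - x/4 ≠ 0 := by
    by_contra! hc
    obtain ⟨rfl, hc⟩ := hc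
    simp at hc h
    exact h hc
  have hg := decay_quartic_pos hx hxq
  have key : potSx x y * fieldX x y + potSy x y * fieldY x y = -(weight x/(x+2)^2*
    (5/2*(y-x/4)^4 - (1/2+5/8*x)*(y-x/4)^3 + (1+27/4*x+63/32*x^2)*(y-x/4)^2
      + x^2*(57/128*x^2+87/32*x+39/4)/4)) := by
    unfold potSx potSy fieldX fieldY potSlope
    field_simp
    ring
  rw [key]
  have : 0 < weight x/(x+2)^2 := by positivity
  exact neg_neg_of_pos (mul_pos this hg)

theorem hasDerivAt_potS {X Y : ℝ → ℝ} {X' Y' t : ℝ} (hX : HasDerivAt X X' t)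
    (hY : HasDerivAt Y Y' t) (hx : -2 < X t) :
    HasDerivAt (fun u => potS (X u) (Y u)) (potSx (X t) (Y t) * X' + potSy (X t) (Y t) * Y') t := by
  have h1 := (hasDerivAt_weight hx).comp t hX
  have h2 := (hasDerivAt_potW hx).comp t hX
  have h3 := ((h1.mul ((hY.sub (hX.div_const 4)).pow 2)).div_const 2).add h2
  refine h3.congr_deriv ?_
  simp only [potSx, potSy, Pi.sub_apply, Pi.pow_apply, Function.comp_apply]
  push_cast
  ring

/-- The bounded part of the phase domain. -/
def InRegion (x y : ℝ) : Prop := -2 < x ∧ -1 < y ∧ x + 4/5*y < 2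

theorem InRegion.x_lt {x y : ℝ} (h : InRegion x y) : x < 14/5 := by
  obtain ⟨_, _, _⟩ := h; linarith

theorem InRegion.y_lt {x y : ℝ} (h : InRegion x y) : y < 5 := by
  obtain ⟨_, _, _⟩ := h; linarith

theorem InRegion.abs_x {x y : ℝ} (h : InRegion x y) : |x| ≤ 3 := by
  have := h.x_lt
  obtain ⟨_, _, _⟩ := h; rw [abs_le]; constructor <;> linarith

theorem InRegion.abs_y {x y : ℝ} (h : InRegion x y) : |y| ≤ 5 := by
  have := h.y_lt
  obtain ⟨_, _, _⟩ := h; rw [abs_le]; constructor <;> linarith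

theorem InRegion.abs_q {x y : ℝ} (h : InRegion x y) : |y - x/4| ≤ 6 := by
  have h1 := abs_le.1 h.abs_x
  have h2 := abs_le.1 h.abs_y
  rw [abs_le]; constructor <;> linarith

theorem abs_weight_slope {x : ℝ} (hx : -2 < x) (hx' : x ≤ 3) : |weight x * potSlope x| ≤ 66 := by
  have h1 := weight_div_le_one hx
  have hp : 0 < x + 2 := by linarith
  have h0 : 0 < weight x / (x+2)^2 := div_pos (weight_pos x) (by positivity)
  have h3 : |x*(57/128*x^2+87/32*x+39/4)| ≤ 66 := by
    have h4 : |x| ≤ 3 := abs_le.2 ⟨by linarith, hx'⟩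
    have h5 : 57/128*x^2+87/32*x+39/4 ≤ 22 := by nlinarith
    rw [abs_mul, abs_of_pos (slope_cubic_pos hx)]
    have := slope_cubic_pos hx
    nlinarith [abs_nonneg x]
  have : weight x * potSlope x = weight x / (x+2)^2 * (x*(57/128*x^2+87/32*x+39/4)) := by
    unfold potSlope; ring
  rw [this, abs_mul, abs_of_pos h0]
  nlinarith [abs_nonneg (x*(57/128*x^2+87/32*x+39/4))]

theorem InRegion.abs_potSy {x y : ℝ} (h : InRegion x y) : |potSy x y| ≤ 6 := by
  have h1 := weight_le_one h.1
  have h2 := h.abs_q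
  rw [potSy, abs_mul, abs_of_pos (weight_pos x)]
  nlinarith [abs_nonneg (y-x/4), weight_pos x]

theorem InRegion.abs_potSx {x y : ℝ} (h : InRegion x y) : |potSx x y| ≤ 500 := by
  have h1 := weight_le_one h.1
  have h2 := weight_div_le_one h.1
  have h3 := abs_le.1 (abs_weight_slope h.1 (by linarith [h.x_lt]))
  have h4 := abs_le.1 h.abs_potSy
  have hp : 0 < x + 2 := by linarith [h.1]
  have h0 : 0 < weight x / (x+2)^2 := div_pos (weight_pos x) (by positivity)
  have h5 : (y-x/4)^2 ≤ 36 := by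
    have := sq_le_sq' (abs_le.1 h.abs_q).1 (abs_le.1 h.abs_q).2
    linarith
  have : potSx x y = weight x / (x+2)^2 * (8*(y-x/4)^2) - potSy x y/4 + weight x * potSlope x := by
    unfold potSx potSy; ring
  rw [this, abs_le]
  constructor <;> nlinarith [sq_nonneg (y-x/4)]

theorem InRegion.potS_le {x y : ℝ} (h : InRegion x y) : potS x y ≤ 300 := by
  have h1 := weight_le_one h.1
  have h5 : (y-x/4)^2 ≤ 36 := by
    have := sq_le_sq' (abs_le.1 h.abs_q).1 (abs_le.1 h.abs_q).2
    linarith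
  have h6 : ‖potW x‖ ≤ 66 * |x - 0| := by
    refine norm_integral_le_of_norm_le_const fun t ht => ?_
    have h7 := h.1
    have h8 := h.x_lt
    rw [Set.uIoc, Set.mem_Ioc] at ht
    refine abs_weight_slope (lt_of_le_of_lt' ht.1.le ?_) (ht.2.trans ?_)
    · exact lt_min (by norm_num) h7
    · exact max_le (by norm_num) (by linarith)
  have h9 := h.abs_x
  have h10 : potW x ≤ 66 * |x| := by
    rw [sub_zero] at h6; exact (le_abs_self _).trans h6
  unfold potS
  nlinarith [sq_nonneg (y-x/4), weight_pos x]

theorem continuousOn_potS : ContinuousOn (fun z : ℝ × ℝ => potS z.1 z.2) {z | -2 < z.1} := by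
  intro z hz
  apply ContinuousAt.continuousWithinAt
  have h1 := (hasDerivAt_weight hz).continuousAt
  have h2 := (hasDerivAt_potW hz).continuousAt
  have h3 : ContinuousAt (fun z : ℝ × ℝ => weight z.1) z := ContinuousAt.comp (f := Prod.fst) h1 continuousAt_fst
  have h4 : ContinuousAt (fun z : ℝ × ℝ => potW z.1) z := ContinuousAt.comp (f := Prod.fst) h2 continuousAt_fst
  unfold potS
  fun_prop

theorem continuousOn_potS_decay : ContinuousOn (fun z : ℝ × ℝ =>
    potSx z.1 z.2 * fieldX z.1 z.2 + potSy z.1 z.2 * fieldY z.1 z.2) {z | -2 < z.1} := by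
  intro z hz
  apply ContinuousAt.continuousWithinAt
  have hp : z.1 + 2 ≠ 0 := by have : -2 < z.1 := hz
                              linarith
  have h1 := (hasDerivAt_weight hz).continuousAt
  have h3 : ContinuousAt (fun z : ℝ × ℝ => weight z.1) z := ContinuousAt.comp (f := Prod.fst) h1 continuousAt_fst
  unfold potSx potSy fieldX fieldY potSlope
  fun_prop (disch := positivity)

/-- The quadratic form adapted to the linearization at the origin. -/
def qform (x y : ℝ) : ℝ := 5/2*x^2 - x*y/2 + y^2

theorem qform_ge (x y : ℝ) : x^2 + y^2 ≤ 2 * qform x y := by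
  unfold qform; nlinarith [sq_nonneg (y - x/2)]

theorem qform_le (x y : ℝ) : qform x y ≤ 4 * (x^2 + y^2) := by
  unfold qform; nlinarith [sq_nonneg (y + x)]

theorem exists_potS_lower : ∃ s₁ : ℝ, 0 < s₁ ∧ ∀ x y, InRegion x y → (1/640)^2 ≤ qform x y →
    2 * s₁ ≤ potS x y := by
  have hc : IsCompact ((Set.Icc (-1:ℝ) 3 ×ˢ Set.Icc (-1:ℝ) 5) ∩ {z | (1/640)^2 ≤ qform z.1 z.2}) := by
    refine (isCompact_Icc.prod isCompact_Icc).inter_right ?_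
    refine isClosed_le continuous_const ?_
    unfold qform; fun_prop
  have hne : ((Set.Icc (-1:ℝ) 3 ×ˢ Set.Icc (-1:ℝ) 5) ∩ {z | (1/640)^2 ≤ qform z.1 z.2}).Nonempty := by
    refine ⟨(1,1), ⟨⟨?_, ?_⟩, ?_⟩⟩ <;> norm_num [qform]
  obtain ⟨z, ⟨⟨hz1, hz2⟩, hz3⟩, hz⟩ := hc.exists_isMinOn hne
    (continuousOn_potS.mono fun z hz => (lt_of_lt_of_le (by norm_num) hz.1.1.1 : -2 < z.1))
  have hzx : -2 < z.1 := lt_of_lt_of_le (by norm_num) hz1.1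
  have hm : 0 < potS z.1 z.2 := by
    refine potS_pos hzx ?_
    by_contra! hcon
    have : (1/640)^2 ≤ qform z.1 z.2 := hz3
    rw [hcon.1, hcon.2] at this
    norm_num [qform] at this
  have hW : 0 < potW (-1) := potW_pos (by norm_num) (by norm_num)
  refine ⟨min (potS z.1 z.2) (potW (-1)) / 2, half_pos (lt_min hm hW), fun x y hxy hn => ?_⟩
  rw [mul_div_cancel₀ _ two_ne_zero]
  rcases lt_or_ge x (-1) with h | h
  · refine (min_le_right _ _).trans ((potW_anti hxy.1 h (by norm_num)).le.trans ?_)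
    have := weight_pos x
    unfold potS
    have : 0 ≤ weight x * (y-x/4)^2/2 := by positivity
    linarith
  · refine (min_le_left _ _).trans ?_
    exact hz (a := (x, y)) ⟨⟨⟨h, by linarith [hxy.x_lt]⟩, ⟨hxy.2.1.le, hxy.y_lt.le⟩⟩, hn⟩

theorem exists_potS_rate {s₁ : ℝ} (hs : 0 < s₁) : ∃ c : ℝ, 0 < c ∧ ∀ x y, InRegion x y →
    1/250 ≤ x + 2 → s₁ ≤ potS x y →
    potSx x y * fieldX x y + potSy x y * fieldY x y ≤ -(c * potS x y) := by
  set D := (Set.Icc (1/250-2:ℝ) 3 ×ˢ Set.Icc (-1:ℝ) 5) with hD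
  have hcD : IsCompact D := isCompact_Icc.prod isCompact_Icc
  have hDsub : D ⊆ {z | -2 < z.1} := fun z hz => (lt_of_lt_of_le (by norm_num) hz.1.1 : -2 < z.1)
  have hc : IsCompact (D ∩ (fun z : ℝ × ℝ => potS z.1 z.2) ⁻¹' Set.Ici s₁) := by
    refine hcD.of_isClosed_subset ?_ Set.inter_subset_left
    exact (continuousOn_potS.mono hDsub).preimage_isClosed_of_isClosed hcD.isClosed isClosed_Ici
  have hcont := (continuousOn_potS_decay.mono hDsub).mono
    (Set.inter_subset_left (t := (fun z : ℝ × ℝ => potS z.1 z.2) ⁻¹' Set.Ici s₁))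
  rcases (D ∩ (fun z : ℝ × ℝ => potS z.1 z.2) ⁻¹' Set.Ici s₁).eq_empty_or_nonempty with he | hne
  · refine ⟨1, one_pos, fun x y hxy hx h => ?_⟩
    have : ((x, y) : ℝ × ℝ) ∈ D ∩ (fun z : ℝ × ℝ => potS z.1 z.2) ⁻¹' Set.Ici s₁ :=
      ⟨⟨⟨by linarith, by linarith [hxy.x_lt]⟩, ⟨hxy.2.1.le, hxy.y_lt.le⟩⟩, h⟩
    rw [he] at this
    exact this.elim
  · obtain ⟨z, ⟨hz1, hz2⟩, hz⟩ := hc.exists_isMaxOn hne hcont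
    have hneg : potSx z.1 z.2 * fieldX z.1 z.2 + potSy z.1 z.2 * fieldY z.1 z.2 < 0 := by
      refine potS_decay (hDsub hz1) ?_
      by_contra! hcon
      have : s₁ ≤ potS z.1 z.2 := hz2
      rw [hcon.1, hcon.2] at this
      simp [potS, potW_zero] at this
      linarith
    set m := potSx z.1 z.2 * fieldX z.1 z.2 + potSy z.1 z.2 * fieldY z.1 z.2 with hm
    refine ⟨-m/300, by linarith, fun x y hxy hx h => ?_⟩
    have h1 : _ ≤ m := hz (a := (x, y))
      ⟨⟨⟨by linarith, by linarith [hxy.x_lt]⟩, ⟨hxy.2.1.le, hxy.y_lt.le⟩⟩, h⟩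
    have h2 := hxy.potS_le
    simp only at h1
    nlinarith

theorem exists_potS_small {s₁ : ℝ} (hs : 0 < s₁) : ∃ η : ℝ, 0 < η ∧ ∀ x y, √(x^2+y^2) < η →
    potS x y < s₁ := by
  have h := (continuousOn_potS.continuousAt (x := (0,0))
    ((isOpen_lt continuous_const continuous_fst).mem_nhds (by simp))).eventually_lt_const
      (u := s₁) (by simpa [potS, potW_zero] using hs)
  obtain ⟨η, hη, hb⟩ := Metric.eventually_nhds_iff.1 h
  refine ⟨η, hη, fun x y hxy => hb (y := (x, y)) ?_⟩
  rw [Prod.dist_eq, Real.dist_eq, Real.dist_eq, sub_zero, sub_zero]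
  refine lt_of_le_of_lt (max_le ?_ ?_) hxy
  · exact Real.abs_le_sqrt (by nlinarith [sq_nonneg y])
  · exact Real.abs_le_sqrt (by nlinarith [sq_nonneg x])

/-- A barrier that is positive only close to the singular boundary `x = -2`. -/
def chi (x y : ℝ) : ℝ := 1/200 - (x+2) - (x+2)^2*y/200

def chiX (x y : ℝ) : ℝ := -1 - (x+2)*y/100

def chiY (x : ℝ) : ℝ := -(x+2)^2/200

theorem InRegion.le_of_chi_nonneg {x y : ℝ} (h : InRegion x y) (hc : 0 ≤ chi x y) :
    x + 2 ≤ 1/100 := by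
  have h1 := h.x_lt
  obtain ⟨h2, h3, -⟩ := h
  unfold chi at hc
  nlinarith [mul_pos (by linarith : 0 < x + 2) (by linarith : 0 < x + 2)]

theorem InRegion.ge_of_chi_nonpos {x y : ℝ} (h : InRegion x y) (hc : chi x y ≤ 0) :
    1/250 ≤ x + 2 := by
  have h1 := h.y_lt
  have h2 := h.1
  unfold chi at hc
  by_contra! hcon
  nlinarith [mul_pos (by linarith : 0 < x + 2) (by linarith : 0 < x + 2)]

theorem InRegion.chi_decay {x y : ℝ} (h : InRegion x y) (hc : 0 ≤ chi x y) :
    chiX x y * fieldX x y + chiY x * fieldY x y ≤ -(1/40) := by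
  have h1 := h.le_of_chi_nonneg hc
  have h2 := h.y_lt
  obtain ⟨h3, h4, -⟩ := h
  have hp : 0 < x + 2 := by linarith
  have hp' : x + 2 ≠ 0 := hp.ne'
  have key : chiX x y * fieldX x y + chiY x * fieldY x y =
    -(y+1) - (x+2)*y*(y+1)/100 + (x+2)/2 + (x+2)^2*y/200
     + 1/80*((y+1)*(y^2+4*y)-4 + (x+2)*(-y^2-4*y) + (x+2)^2*(y+1)) := by
    unfold chiX chiY fieldX fieldY
    field_simp
    ring
  rw [key]
  have e1 : (y+1)*(y^2+4*y-80) ≤ 0 := mul_nonpos_of_nonneg_of_nonpos (by linarith) (by nlinarith)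
  have e2 : (x+2)*(-(y*(y+1))) ≤ 1/100*1 := by
    have : -(y*(y+1)) ≤ 1 := by nlinarith [sq_nonneg (y+1/2)]
    calc (x+2)*(-(y*(y+1))) ≤ (x+2)*1 := by gcongr
      _ ≤ _ := by linarith
  have e3 : (x+2)*(-y^2-4*y) ≤ 1/100*4 := by
    have : -y^2-4*y ≤ 4 := by nlinarith [sq_nonneg (y+2)]
    calc (x+2)*(-y^2-4*y) ≤ (x+2)*4 := by gcongr
      _ ≤ _ := by linarith
  have e4 : (x+2)^2 ≤ 1/100 * (1/100) := by nlinarith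
  have e5 : (x+2)^2*(y+1) ≤ 1/10000*6 := by
    calc (x+2)^2*(y+1) ≤ (1/100 * (1/100))*6 := by gcongr <;> linarith
      _ ≤ _ := by norm_num
  have e6 : (x+2)^2*y ≤ (x+2)^2*(y+1) := by nlinarith
  nlinarith

theorem InRegion.abs_chiX {x y : ℝ} (h : InRegion x y) : |chiX x y| ≤ 2 := by
  have h1 := h.y_lt
  have h0 := h.x_lt
  obtain ⟨h3, h4, -⟩ := h
  unfold chiX
  rw [abs_le]
  constructor <;> nlinarith

theorem InRegion.abs_chiY {x y : ℝ} (h : InRegion x y) : |chiY x| ≤ 2 := by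
  have h0 := h.x_lt
  obtain ⟨h3, h4, -⟩ := h
  unfold chiY
  rw [abs_le]
  constructor <;> nlinarith

theorem InRegion.abs_chi {x y : ℝ} (h : InRegion x y) : |chi x y| ≤ 7 := by
  have h0 := h.x_lt
  have h1 := h.y_lt
  obtain ⟨h3, h4, -⟩ := h
  have e4 : (x+2)^2 ≤ 25 := by nlinarith
  have e5 : |(x+2)^2*y/200| ≤ 1 := by
    rw [abs_div, abs_mul, abs_of_nonneg (sq_nonneg (x+2)), abs_of_pos (by norm_num : (0:ℝ) < 200)]
    have : |y| ≤ 5 := abs_le.2 ⟨by linarith, h1.le⟩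
    rw [div_le_one (by norm_num)]
    nlinarith [abs_nonneg y, sq_nonneg (x+2)]
  have e6 := abs_le.1 e5
  unfold chi
  rw [abs_le]
  constructor <;> linarith

theorem InRegion.chi_le {x y : ℝ} (h : InRegion x y) (hc : 0 ≤ chi x y) : chi x y ≤ 1/100 := by
  have := h.le_of_chi_nonneg hc
  obtain ⟨h3, h4, -⟩ := h
  have e4 : (x+2)^2 ≤ 1/100 * (1/100) := by nlinarith
  unfold chi
  nlinarith [sq_nonneg (x+2)]

theorem hasDerivAt_chi {X Y : ℝ → ℝ} {X' Y' t : ℝ} (hX : HasDerivAt X X' t)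
    (hY : HasDerivAt Y Y' t) :
    HasDerivAt (fun u => chi (X u) (Y u)) (chiX (X t) (Y t) * X' + chiY (X t) * Y') t := by
  have h := (((hX.add_const (2:ℝ)).const_sub (1/200))).sub
    ((((hX.add_const (2:ℝ)).pow 2).mul hY).div_const 200)
  refine h.congr_deriv ?_
  simp only [chiX, chiY, Pi.pow_apply]
  push_cast
  ring

/-- The local Lyapunov function near the origin. -/
def near (x y : ℝ) : ℝ := √(qform x y) + 320 * qform x y

def nearCoef (x y : ℝ) : ℝ := (1 + 640 * √(qform x y)) / (2 * √(qform x y))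

theorem qform_nonneg (x y : ℝ) : 0 ≤ qform x y := by
  have := qform_ge x y
  nlinarith [sq_nonneg x, sq_nonneg y]

theorem qform_pos {x y : ℝ} (h : x ≠ 0 ∨ y ≠ 0) : 0 < qform x y := by
  have := qform_ge x y
  have : 0 < x^2+y^2 := by rcases h with h | h <;> positivity
  linarith

theorem hasDerivAt_near {X Y : ℝ → ℝ} {X' Y' t : ℝ} (hX : HasDerivAt X X' t)
    (hY : HasDerivAt Y Y' t) (h0 : X t ≠ 0 ∨ Y t ≠ 0) :
    HasDerivAt (fun u => near (X u) (Y u))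
      (nearCoef (X t) (Y t) * (5*X t - Y t/2) * X'
        + nearCoef (X t) (Y t) * (2*Y t - X t/2) * Y') t := by
  have hn := qform_pos h0
  have hq : HasDerivAt (fun u => qform (X u) (Y u)) ((5*X t - Y t/2)*X' + (2*Y t - X t/2)*Y') t := by
    have := (((hX.pow 2).const_mul (5/2:ℝ)).sub ((hX.mul hY).div_const 2)).add (hY.pow 2)
    refine this.congr_deriv ?_
    push_cast
    ring
  have h := (hq.sqrt hn.ne').add (hq.const_mul 320)
  refine h.congr_deriv ?_
  have : √(qform (X t) (Y t)) ≠ 0 := (Real.sqrt_pos.2 hn).ne'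
  unfold nearCoef
  field_simp
  ring

section near

variable {x y : ℝ}

theorem abs_le_sqrt_qform (x y : ℝ) : |x| ≤ √(qform x y) ∧ |y| ≤ 2 * √(qform x y) ∧
    |y - x/4| ≤ √(qform x y) := by
  have e : (2:ℝ) * √(qform x y) = √(4 * qform x y) := by
    rw [Real.sqrt_mul (by norm_num), show (4:ℝ) = 2^2 by norm_num, Real.sqrt_sq (by norm_num)]
  rw [e]
  refine ⟨Real.abs_le_sqrt ?_, Real.abs_le_sqrt ?_, Real.abs_le_sqrt ?_⟩ <;> unfold qform <;>
    nlinarith [sq_nonneg (y-x/4), sq_nonneg x, sq_nonneg (x-y)]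

theorem near_decay (h : qform x y < (1/640)^2) (h0 : x ≠ 0 ∨ y ≠ 0) :
    nearCoef x y * (5*x-y/2) * fieldX x y + nearCoef x y * (2*y-x/2) * fieldY x y
      ≤ -near x y / 4 := by
  have hq := qform_pos h0
  obtain ⟨hx, hy, hd⟩ := abs_le_sqrt_qform x y
  have hsq : √(qform x y)^2 = qform x y := Real.sq_sqrt hq.le
  have hN : 0 < √(qform x y) := Real.sqrt_pos.2 hq
  have hN' : √(qform x y) < 1/640 := by
    rw [Real.sqrt_lt' (by norm_num)]; exact h
  unfold near nearCoef
  set N := √(qform x y) with hNdef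
  have hp : 1 ≤ x + 2 := by linarith [(abs_le.1 hx).1]
  have hp' : x + 2 ≠ 0 := by linarith
  have key : (5*x-y/2) * fieldX x y + (2*y-x/2) * fieldY x y = -qform x y/2
      + 2*(y-x/4)*(5/2*((x-y)*(x^2+y^2+3*x+3*y))/(x+2)^2) := by
    unfold fieldX fieldY qform
    field_simp
    ring
  have b1 : |x - y| ≤ 3*N := (abs_sub _ _).trans (by linarith)
  have b2 : |x^2+y^2+3*x+3*y| ≤ 10*N := by
    have := qform_ge x y
    have e1 := abs_le.1 hx
    have e2 := abs_le.1 hy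
    rw [abs_le]; constructor <;> nlinarith [sq_nonneg x, sq_nonneg y]
  have b3 : |5/2*((x-y)*(x^2+y^2+3*x+3*y))/(x+2)^2| ≤ 40*N^2 := by
    rw [abs_div, abs_mul, abs_mul, abs_of_pos (by norm_num : (0:ℝ)<5/2), abs_of_nonneg (sq_nonneg (x+2))]
    have e := mul_le_mul b1 b2 (abs_nonneg _) (by positivity)
    rw [div_le_iff₀ (by positivity)]
    have e2 : 2 ≤ (x+2)^2 := by nlinarith [(abs_le.1 hx).1]
    nlinarith [mul_le_mul_of_nonneg_left e2 (by positivity : 0 ≤ N^2)]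
  have b4 : 2*(y-x/4)*(5/2*((x-y)*(x^2+y^2+3*x+3*y))/(x+2)^2) ≤ 80*N^3 := by
    have e := mul_le_mul hd b3 (abs_nonneg _) hN.le
    rw [← abs_mul] at e
    linarith [le_abs_self ((y-x/4)*(5/2*((x-y)*(x^2+y^2+3*x+3*y))/(x+2)^2))]
  have main : (5*x-y/2) * fieldX x y + (2*y-x/2) * fieldY x y ≤ -N^2/2 + 80*N^3 := by
    rw [key, hsq]; linarith
  have e : (1+640*N)/(2*N) * (5*x-y/2) * fieldX x y + (1+640*N)/(2*N) * (2*y-x/2) * fieldY x y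
    = (1+640*N)/(2*N) * ((5*x-y/2) * fieldX x y + (2*y-x/2) * fieldY x y) := by ring
  rw [e]
  calc _ ≤ (1+640*N)/(2*N) * (-N^2/2 + 80*N^3) := by gcongr
    _ = (1+640*N)*(-N/4+40*N^2) := by field_simp; ring
    _ ≤ -(N + 320*N^2)/4 := by nlinarith [mul_pos hN hN]
    _ = _ := by rw [hsq]

end near

/-- A function of the phase variables with its gradient, taken into account where `guard < 0`. -/
structure Piece where
  guard : ℝ → ℝ → ℝ
  value : ℝ → ℝ → ℝ
  dX : ℝ → ℝ → ℝ
  dY : ℝ → ℝ → ℝ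

/-- The domain of the rescaled system. -/
def phaseDomain : Set (ℝ × ℝ) := {z | -2 < z.1 ∧ -1 < z.2}

/-- A finite family of pieces whose maximum is a Lyapunov function, comparable to the Euclidean
norm, decaying at rate `1/4` along the autonomous field. -/
structure IsBarrier (P : Set Piece) (C c : ℝ) : Prop where
  finite : P.Finite
  pos_C : 0 < C
  pos_c : 0 < c
  guard_cont : ∀ p ∈ P, ContinuousOn (fun z : ℝ × ℝ => p.guard z.1 z.2) phaseDomain
  value_cont : ∀ p ∈ P, ContinuousOn (fun z : ℝ × ℝ => p.value z.1 z.2) phaseDomain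
  hasDerivAt : ∀ p ∈ P, ∀ (X Y : ℝ → ℝ) (X' Y' t : ℝ), HasDerivAt X X' t → HasDerivAt Y Y' t →
    -2 < X t → (X t ≠ 0 ∨ Y t ≠ 0) →
    HasDerivAt (fun u => p.value (X u) (Y u)) (p.dX (X t) (Y t) * X' + p.dY (X t) (Y t) * Y') t
  active : ∀ p ∈ P, ∀ x y, -2 < x → -1 < y → p.guard x y < 0 → 0 < p.value x y →
    (∀ p' ∈ P, p'.guard x y < 0 → p'.value x y ≤ p.value x y) →
    p.dX x y * fieldX x y + p.dY x y * fieldY x y ≤ -p.value x y / 4 ∧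
      |p.dX x y| ≤ C ∧ |p.dY x y| ≤ C ∧ |p.value x y - (p.dX x y * x + p.dY x y * y)| ≤ C
  dominated : ∀ p ∈ P, ∀ x y, -2 < x → -1 < y → 0 ≤ p.guard x y →
    ∃ p' ∈ P, p'.guard x y < 0 ∧ ∃ m < p'.value x y, ∀ x' y', -2 < x' → -1 < y' →
      p.guard x' y' < 0 → p.value x' y' ≤ m
  lower : ∀ x y, -2 < x → -1 < y → ∃ p ∈ P, p.guard x y < 0 ∧ c * √(x^2+y^2) ≤ p.value x y
  upper : ∀ p ∈ P, ∀ x y, -2 < x → -1 < y → p.guard x y < 0 → p.value x y ≤ C * √(x^2+y^2)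

def nearPiece : Piece where
  guard x y := qform x y - (1/640)^2
  value := near
  dX x y := nearCoef x y * (5*x - y/2)
  dY x y := nearCoef x y * (2*y - x/2)

def midPiece (κ s : ℝ) (k : ℕ) : Piece where
  guard x y := x + 4/5*y - 2
  value x y := κ * (potS x y^(k+1) - s)
  dX x y := κ * ((k+1) * potS x y^k * potSx x y)
  dY x y := κ * ((k+1) * potS x y^k * potSy x y)

def edgePiece (κ s κ' : ℝ) (k : ℕ) : Piece where
  guard x y := x + 4/5*y - 2
  value x y := κ * (potS x y^(k+1) - s) + κ' * chi x y
  dX x y := κ * ((k+1) * potS x y^k * potSx x y) + κ' * chiX x y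
  dY x y := κ * ((k+1) * potS x y^k * potSy x y) + κ' * chiY x

def farPiece (κ : ℝ) : Piece where
  guard _ _ := -1
  value x y := κ * (x + 4/5*y - 1)
  dX _ _ := κ
  dY _ _ := κ * (4/5)

theorem near_le {x y : ℝ} (h : qform x y < (1/640)^2) : near x y ≤ 3/2 * √(qform x y) := by
  have hsq : √(qform x y)^2 = qform x y := Real.sq_sqrt (qform_nonneg x y)
  have hN' : √(qform x y) < 1/640 := by
    rw [Real.sqrt_lt' (by norm_num)]; exact h
  unfold near
  rw [← hsq]
  rw [Real.sqrt_sq (Real.sqrt_nonneg _)]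
  nlinarith [Real.sqrt_nonneg (qform x y)]

theorem near_bounds {x y : ℝ} (h : qform x y < (1/640)^2) (h0 : x ≠ 0 ∨ y ≠ 0) :
    |nearCoef x y * (5*x - y/2)| ≤ 6 ∧ |nearCoef x y * (2*y - x/2)| ≤ 6 ∧
    |near x y - (nearCoef x y * (5*x - y/2) * x + nearCoef x y * (2*y - x/2) * y)| ≤ 6 := by
  have hq := qform_pos h0
  obtain ⟨hx, hy, hd⟩ := abs_le_sqrt_qform x y
  have hsq : √(qform x y)^2 = qform x y := Real.sq_sqrt hq.le
  have hN : 0 < √(qform x y) := Real.sqrt_pos.2 hq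
  have hN' : √(qform x y) < 1/640 := by
    rw [Real.sqrt_lt' (by norm_num)]; exact h
  have hdef : ∀ N : ℝ, N^2 = qform x y → 0 < N →
    near x y - (nearCoef x y * (5*x - y/2) * x + nearCoef x y * (2*y - x/2) * y)
    = -(320 * N^2) := by
    intro N h1 h2
    have h3 : √(qform x y) = N := by rw [← h1, Real.sqrt_sq h2.le]
    have e : nearCoef x y * (5*x - y/2) * x + nearCoef x y * (2*y - x/2) * y
      = nearCoef x y * (2 * qform x y) := by unfold qform; ring
    rw [e]
    unfold near nearCoef
    rw [h3, ← h1]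
    field_simp
    ring
  have e3 := hdef _ hsq hN
  rw [e3]
  unfold nearCoef
  set N := √(qform x y)
  have ex := abs_le.1 hx
  have ey := abs_le.1 hy
  have hc : 0 ≤ (1+640*N)/(2*N) := by positivity
  have hb : ∀ u, |u| ≤ 6*N → |(1+640*N)/(2*N) * u| ≤ 6 := by
    intro u hu
    rw [abs_mul, abs_of_nonneg hc]
    calc _ ≤ (1+640*N)/(2*N) * (6*N) := by gcongr
      _ = 3*(1+640*N) := by field_simp; ring
      _ ≤ 6 := by linarith
  refine ⟨hb _ ?_, hb _ ?_, ?_⟩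
  · rw [abs_le]; constructor <;> linarith
  · rw [abs_le]; constructor <;> linarith
  · rw [abs_neg, abs_of_nonneg (by positivity)]; nlinarith

theorem InRegion.abs_mid {x y κ : ℝ} {k : ℕ} (hκ : 0 < κ) (h : InRegion x y) :
    |κ * ((k+1) * potS x y^k * potSx x y)| ≤ κ * ((k+1) * 300^k * 500) ∧
    |κ * ((k+1) * potS x y^k * potSy x y)| ≤ κ * ((k+1) * 300^k * 500) := by
  have h0 := potS_nonneg h.1 y
  have h1 := h.potS_le
  have hx := h.abs_potSx
  have hy := h.abs_potSy.trans (by norm_num : (6:ℝ) ≤ 500)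
  have h2 : potS x y^k ≤ 300^k := by gcongr
  constructor <;>
  · rw [abs_mul, abs_mul, abs_mul, abs_of_pos hκ, abs_of_pos (by positivity : (0:ℝ) < k+1),
      abs_of_nonneg (by positivity : 0 ≤ potS x y^k)]
    gcongr

theorem hasDerivAt_mid {X Y : ℝ → ℝ} {X' Y' t κ s : ℝ} {k : ℕ} (hX : HasDerivAt X X' t)
    (hY : HasDerivAt Y Y' t) (hx : -2 < X t) :
    HasDerivAt (fun u => κ * (potS (X u) (Y u)^(k+1) - s))
      (κ * ((k+1) * potS (X t) (Y t)^k * potSx (X t) (Y t)) * X' +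
        κ * ((k+1) * potS (X t) (Y t)^k * potSy (X t) (Y t)) * Y') t := by
  have h := (((hasDerivAt_potS hX hY hx).pow (k+1)).sub_const s).const_mul κ
  refine h.congr_deriv ?_
  simp only [Nat.add_sub_cancel]
  push_cast
  ring

set_option maxHeartbeats 4000000 in
theorem exists_isBarrier : ∃ P C c, IsBarrier P C c := by
  obtain ⟨s₁, hs, hlow⟩ := exists_potS_lower
  obtain ⟨r, hr, hrate⟩ := exists_potS_rate hs
  obtain ⟨η', hη', hsmall'⟩ := exists_potS_small hs
  obtain ⟨η, hη, hη1, hsmall⟩ : ∃ η : ℝ, 0 < η ∧ η ≤ 1 ∧ ∀ x y, √(x^2+y^2) < η →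
      potS x y < s₁ := ⟨min η' 1, lt_min hη' one_pos, min_le_right _ _,
        fun x y h => hsmall' x y (h.trans_le (min_le_left _ _))⟩
  obtain ⟨k, hk⟩ : ∃ k : ℕ, 1 ≤ (k+1) * r := by
    obtain ⟨k, hk⟩ := exists_nat_ge (1/r)
    refine ⟨k, ?_⟩
    rw [div_le_iff₀ hr] at hk
    linarith
  obtain ⟨s, hs_def⟩ : ∃ s, s = s₁^(k+1) := ⟨_, rfl⟩
  have hs0 : 0 < s := by rw [hs_def]; positivity
  obtain ⟨κ, hκ_def⟩ : ∃ κ, κ = 1/s := ⟨_, rfl⟩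
  have hκ : 0 < κ := by rw [hκ_def]; positivity
  have hκs : κ * s = 1 := by rw [hκ_def]; field_simp
  obtain ⟨T, hT⟩ : ∃ T : ℝ, T = κ * 300^(k+1) := ⟨_, rfl⟩
  have hT0 : 0 < T := by rw [hT]; positivity
  obtain ⟨D, hD⟩ : ∃ D : ℝ, D = κ * ((k+1) * 300^k * 500) := ⟨_, rfl⟩
  have hD0 : 0 < D := by rw [hD]; positivity
  have hC0 : 0 < 10 + 1000*T + 8*D + 141*T/η := by positivity
  have hTη : 0 < 141*T/η := by positivity
  have hmid : ∀ x y, InRegion x y → κ * (potS x y^(k+1) - s) ≤ T - 1 := by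
    intro x y h
    have h0 := potS_nonneg h.1 y
    have h1 := h.potS_le
    have : κ * potS x y^(k+1) ≤ T := by rw [hT]; gcongr
    linarith
  have hmid' : ∀ x y, InRegion x y → -1 ≤ κ * (potS x y^(k+1) - s) := by
    intro x y h
    have h0 := potS_nonneg h.1 y
    have : 0 ≤ κ * potS x y^(k+1) := by positivity
    linarith
  have hmid1 : ∀ x y, InRegion x y → (1/640)^2 ≤ qform x y → 1 ≤ κ * (potS x y^(k+1) - s) := by
    intro x y h hq
    have h0 := hlow x y h hq
    have h1 : 2 * s ≤ potS x y^(k+1) := by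
      calc 2 * s ≤ 2^(k+1) * s := by
            gcongr
            exact le_self_pow₀ (by norm_num) (by simp)
        _ = (2*s₁)^(k+1) := by rw [hs_def, mul_pow]
        _ ≤ _ := by gcongr
    nlinarith
  have hsmall2 : ∀ x y, InRegion x y → √(x^2+y^2) < η → κ * (potS x y^(k+1) - s) ≤ 0 := by
    intro x y h hxy
    have h0 := hsmall x y hxy
    have h1 := potS_nonneg h.1 y
    have : potS x y^(k+1) ≤ s := by rw [hs_def]; gcongr
    nlinarith
  have hsmallchi : ∀ x y, InRegion x y → √(x^2+y^2) < η → chi x y ≤ 0 := by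
    intro x y h hxy
    by_contra! hc
    have h1 := h.le_of_chi_nonneg hc.le
    have h2 : |x| ≤ √(x^2+y^2) := Real.abs_le_sqrt (by nlinarith [sq_nonneg y])
    have := (abs_le.1 h2).1
    linarith
  have region : ∀ x y, -2 < x → -1 < y → x + 4/5*y - 2 < 0 → InRegion x y :=
    fun x y h1 h2 h3 => ⟨h1, h2, by linarith⟩
  refine ⟨{nearPiece, midPiece κ s k, edgePiece κ s (20*T) k, farPiece (141*T+1)},
    10 + 1000*T + 8*D + 141*T/η, 1/10, ?_⟩
  have cS : ContinuousOn (fun z : ℝ × ℝ => potS z.1 z.2) phaseDomain :=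
    continuousOn_potS.mono fun z hz => hz.1
  refine ⟨by simp, hC0, by norm_num, ?_, ?_, ?_, ?_, ?_, ?_, ?_⟩
  · rintro p (rfl | rfl | rfl | rfl) <;> apply Continuous.continuousOn
    · simp only [nearPiece, qform]; fun_prop
    · simp only [midPiece]; fun_prop
    · simp only [edgePiece]; fun_prop
    · simp only [farPiece]; fun_prop
  · rintro p (rfl | rfl | rfl | rfl)
    · apply Continuous.continuousOn
      simp only [nearPiece, near, qform]; fun_prop
    · simp only [midPiece]; fun_prop
    · simp only [edgePiece, chi]; fun_prop
    · apply Continuous.continuousOn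
      simp only [farPiece]; fun_prop
  · rintro p (rfl | rfl | rfl | rfl) X Y X' Y' t hX hY hx h0
    · exact hasDerivAt_near hX hY h0
    · exact hasDerivAt_mid hX hY hx
    · have := (hasDerivAt_mid (κ := κ) (s := s) (k := k) hX hY hx).add
        ((hasDerivAt_chi hX hY).const_mul (20*T))
      refine this.congr_deriv ?_
      simp only [edgePiece]
      ring
    · have := ((hX.add (hY.const_mul (4/5))).sub_const 1).const_mul (141*T+1)
      refine this.congr_deriv ?_
      simp only [farPiece]
      ring
  · rintro p (rfl | rfl | rfl | rfl) x y hx hy hg hv hmax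
    · have hq : qform x y < (1/640)^2 := by simpa [nearPiece] using hg
      have h0 : x ≠ 0 ∨ y ≠ 0 := by
        by_contra! hcon
        rw [hcon.1, hcon.2] at hv
        simp [nearPiece, near, qform] at hv
      obtain ⟨b1, b2, b3⟩ := near_bounds hq h0
      have hC : 6 ≤ 10 + 1000*T + 8*D + 141*T/η := by linarith
      exact ⟨near_decay hq h0, b1.trans hC, b2.trans hC, b3.trans hC⟩
    · have hR := region x y hx hy hg
      have hchi : chi x y ≤ 0 := by
        have := hmax (edgePiece κ s (20*T) k) (by simp) hg
        simp only [edgePiece, midPiece] at this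
        by_contra! hc
        have : 0 < 20*T*chi x y := by positivity
        linarith
      have hS0 := potS_nonneg hx y
      have hS : s₁ ≤ potS x y := by
        by_contra! hc
        have : potS x y^(k+1) ≤ s := by rw [hs_def]; gcongr
        have : κ * (potS x y^(k+1) - s) ≤ 0 := by nlinarith
        simp only [midPiece] at hv
        linarith
      have hd := hrate x y hR (hR.ge_of_chi_nonpos hchi) hS
      obtain ⟨b1, b2⟩ := hR.abs_mid (k := k) hκ
      rw [← hD] at b1 b2
      have b3 := hmid x y hR
      have b4 := hmid' x y hR
      simp only [midPiece]
      refine ⟨?_, by linarith, by linarith, ?_⟩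
      · have e : κ * ((k+1) * potS x y^k * potSx x y) * fieldX x y
            + κ * ((k+1) * potS x y^k * potSy x y) * fieldY x y
            = κ * (k+1) * potS x y^k * (potSx x y * fieldX x y + potSy x y * fieldY x y) := by ring
        rw [e]
        have e1 : κ * (k+1) * potS x y^k * (potSx x y * fieldX x y + potSy x y * fieldY x y)
            ≤ κ * (k+1) * potS x y^k * (-(r * potS x y)) := by gcongr
        have e2 : κ * (k+1) * potS x y^k * (-(r * potS x y))
            = -(((k+1)*r) * (κ * potS x y^(k+1))) := by ring
        have e3 : 0 ≤ κ * potS x y^(k+1) := by positivity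
        nlinarith
      · have c1 : |κ * ((k+1) * potS x y^k * potSx x y) * x| ≤ D * 3 := by
          rw [abs_mul]; exact mul_le_mul b1 hR.abs_x (abs_nonneg _) hD0.le
        have c2 : |κ * ((k+1) * potS x y^k * potSy x y) * y| ≤ D * 5 := by
          rw [abs_mul]; exact mul_le_mul b2 hR.abs_y (abs_nonneg _) hD0.le
        rw [abs_le] at c1 c2 ⊢
        constructor <;> linarith
    · have hR := region x y hx hy hg
      have hchi : 0 ≤ chi x y := by
        have := hmax (midPiece κ s k) (by simp) hg
        simp only [edgePiece, midPiece] at this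
        by_contra! hc
        have : 20*T*chi x y < 0 := mul_neg_of_pos_of_neg (by positivity) hc
        linarith
      have hS0 := potS_nonneg hx y
      have hcd := hR.chi_decay hchi
      have hcl := hR.chi_le hchi
      have hxne : x ≠ 0 := by have := hR.le_of_chi_nonneg hchi; linarith
      have hd := (potS_decay (y := y) hx (Or.inl hxne)).le
      obtain ⟨b1, b2⟩ := hR.abs_mid (k := k) hκ
      rw [← hD] at b1 b2
      have b3 := hmid x y hR
      have b4 := hmid' x y hR
      have d1 : |20*T*chiX x y| ≤ 40*T := by
        rw [abs_mul, abs_of_pos (by positivity)]; nlinarith [hR.abs_chiX]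
      have d2 : |20*T*chiY x| ≤ 40*T := by
        rw [abs_mul, abs_of_pos (by positivity)]; nlinarith [hR.abs_chiY]
      have f1 : |κ * ((k+1) * potS x y^k * potSx x y) + 20*T*chiX x y| ≤ D + 40*T :=
        (abs_add_le _ _).trans (by linarith)
      have f2 : |κ * ((k+1) * potS x y^k * potSy x y) + 20*T*chiY x| ≤ D + 40*T :=
        (abs_add_le _ _).trans (by linarith)
      simp only [edgePiece]
      refine ⟨?_, by linarith, by linarith, ?_⟩
      · have e : (κ * ((k+1) * potS x y^k * potSx x y) + 20*T*chiX x y) * fieldX x y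
            + (κ * ((k+1) * potS x y^k * potSy x y) + 20*T*chiY x) * fieldY x y
            = κ * (k+1) * potS x y^k * (potSx x y * fieldX x y + potSy x y * fieldY x y)
              + 20*T*(chiX x y * fieldX x y + chiY x * fieldY x y) := by ring
        rw [e]
        have e1 : κ * (k+1) * potS x y^k * (potSx x y * fieldX x y + potSy x y * fieldY x y) ≤ 0 :=
          mul_nonpos_of_nonneg_of_nonpos (by positivity) hd
        nlinarith
      · have g1 : |20*T*chi x y| ≤ T := by
          rw [abs_of_nonneg (by positivity)]; nlinarith
        have c1 : |(κ * ((k+1) * potS x y^k * potSx x y) + 20*T*chiX x y) * x| ≤ (D+40*T) * 3 := by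
          rw [abs_mul]; exact mul_le_mul f1 hR.abs_x (abs_nonneg _) (by positivity)
        have c2 : |(κ * ((k+1) * potS x y^k * potSy x y) + 20*T*chiY x) * y| ≤ (D+40*T) * 5 := by
          rw [abs_mul]; exact mul_le_mul f2 hR.abs_y (abs_nonneg _) (by positivity)
        rw [abs_le] at c1 c2 g1 ⊢
        constructor <;> linarith
    · have hl : 1 ≤ x + 4/5*y := by
        simp only [farPiece] at hv
        have := pos_of_mul_pos_right hv (by positivity)
        linarith
      have := linear_decay hx hy hl
      have hk0 : 0 < 141*T+1 := by positivity
      simp only [farPiece]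
      refine ⟨?_, ?_, ?_, ?_⟩
      · nlinarith
      · rw [abs_of_pos hk0]; linarith
      · rw [abs_of_pos (by positivity)]; linarith
      · rw [abs_le]; constructor <;> linarith
  · rintro p (rfl | rfl | rfl | rfl) x y hx hy hg
    · have hq : (1/640)^2 ≤ qform x y := by simpa [nearPiece] using hg
      have hm : ∀ x' y', -2 < x' → -1 < y' → nearPiece.guard x' y' < 0 →
          nearPiece.value x' y' ≤ 1/2 := by
        intro x' y' _ _ h
        have h : qform x' y' < (1/640)^2 := by simpa [nearPiece] using h
        have h1 := near_le h
        have hN' : √(qform x' y') < 1/640 := by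
          rw [Real.sqrt_lt' (by norm_num)]; exact h
        simp only [nearPiece]
        linarith
      rcases lt_or_ge (x+4/5*y) 2 with hl | hl
      · refine ⟨midPiece κ s k, by simp, by simp only [midPiece]; linarith, 1/2, ?_, hm⟩
        have := hmid1 x y ⟨hx, hy, hl⟩ hq
        simp only [midPiece]; linarith
      · refine ⟨farPiece (141*T+1), by simp, by simp [farPiece], 1/2, ?_, hm⟩
        simp only [farPiece]; nlinarith
    · refine ⟨farPiece (141*T+1), by simp, by simp [farPiece], 141*T, ?_, ?_⟩
      · simp only [farPiece, midPiece] at hg ⊢; nlinarith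
      · intro x' y' hx' hy' h
        have := hmid x' y' (region x' y' hx' hy' h)
        simp only [midPiece]; linarith
    · refine ⟨farPiece (141*T+1), by simp, by simp [farPiece], 141*T, ?_, ?_⟩
      · simp only [farPiece, edgePiece] at hg ⊢; nlinarith
      · intro x' y' hx' hy' h
        have hR := region x' y' hx' hy' h
        have := hmid x' y' hR
        have := (abs_le.1 hR.abs_chi).2
        simp only [edgePiece]; nlinarith
    · simp only [farPiece] at hg; linarith
  · intro x y hx hy
    rcases lt_or_ge (qform x y) ((1/640)^2) with hq | hq
    · refine ⟨nearPiece, by simp, by simpa [nearPiece] using hq, ?_⟩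
      have h1 : √(x^2+y^2) ≤ 2 * √(qform x y) := by
        rw [Real.sqrt_le_left (by positivity), mul_pow, Real.sq_sqrt (qform_nonneg x y)]
        linarith [qform_ge x y, qform_nonneg x y]
      have := qform_nonneg x y
      simp only [nearPiece, near]
      linarith [Real.sqrt_nonneg (qform x y)]
    · rcases lt_or_ge (x+4/5*y) 2 with hl | hl
      · have hR : InRegion x y := ⟨hx, hy, hl⟩
        refine ⟨midPiece κ s k, by simp, by simp only [midPiece]; linarith, ?_⟩
        have h1 := hmid1 x y hR hq
        have h2 : √(x^2+y^2) ≤ 10 := by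
          rw [Real.sqrt_le_left (by norm_num)]
          have a1 := sq_le_sq' (abs_le.1 hR.abs_x).1 (abs_le.1 hR.abs_x).2
          have a2 := sq_le_sq' (abs_le.1 hR.abs_y).1 (abs_le.1 hR.abs_y).2
          linarith
        simp only [midPiece]; linarith
      · refine ⟨farPiece (141*T+1), by simp, by simp [farPiece], ?_⟩
        have h2 : √(x^2+y^2) ≤ 9/2*(x+4/5*y) := by
          rw [Real.sqrt_le_left (by linarith)]
          have a1 : |x| ≤ x + 4 := abs_le.2 ⟨by linarith, by linarith⟩
          have a2 : |y| ≤ y + 2 := abs_le.2 ⟨by linarith, by linarith⟩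
          have a3 : |x| + |y| ≤ 9/2*(x+4/5*y) := by linarith
          have a4 : (|x|+|y|)^2 ≤ (9/2*(x+4/5*y))^2 := by gcongr
          nlinarith [sq_abs x, sq_abs y, mul_nonneg (abs_nonneg x) (abs_nonneg y)]
        simp only [farPiece]
        nlinarith
  · rintro p (rfl | rfl | rfl | rfl) x y hx hy hg
    · have hq : qform x y < (1/640)^2 := by simpa [nearPiece] using hg
      have h1 := near_le hq
      have h2 : √(qform x y) ≤ 2 * √(x^2+y^2) := by
        rw [Real.sqrt_le_left (by positivity), mul_pow, Real.sq_sqrt (by positivity)]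
        linarith [qform_le x y]
      simp only [nearPiece]
      nlinarith [Real.sqrt_nonneg (x^2+y^2)]
    · have hR := region x y hx hy hg
      have h0 := Real.sqrt_nonneg (x^2+y^2)
      simp only [midPiece]
      rcases lt_or_ge (√(x^2+y^2)) η with h | h
      · exact (hsmall2 x y hR h).trans (by positivity)
      · have e : 141*T ≤ 141*T/η * √(x^2+y^2) := by
          rw [div_mul_eq_mul_div, le_div_iff₀ hη]; gcongr
        have := hmid x y hR
        nlinarith [mul_nonneg hT0.le h0, mul_nonneg hD0.le h0]
    · have hR := region x y hx hy hg
      have h0 := Real.sqrt_nonneg (x^2+y^2)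
      simp only [edgePiece]
      rcases lt_or_ge (√(x^2+y^2)) η with h | h
      · have h1 := hsmall2 x y hR h
        have h2 := hsmallchi x y hR h
        have h3 : 20*T*chi x y ≤ 0 := mul_nonpos_of_nonneg_of_nonpos (by positivity) h2
        have : 0 ≤ (10 + 1000*T + 8*D + 141*T/η) * √(x^2+y^2) := by positivity
        linarith
      · have e : 141*T ≤ 141*T/η * √(x^2+y^2) := by
          rw [div_mul_eq_mul_div, le_div_iff₀ hη]; gcongr
        have := hmid x y hR
        have := (abs_le.1 hR.abs_chi).2
        have e3 : 20*T*chi x y ≤ 20*T*7 := by gcongr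
        nlinarith [mul_nonneg hT0.le h0, mul_nonneg hD0.le h0]
    · have h0 := Real.sqrt_nonneg (x^2+y^2)
      have h2 : x ≤ √(x^2+y^2) := Real.le_sqrt_of_sq_le (by nlinarith [sq_nonneg y])
      have h3 : y ≤ √(x^2+y^2) := Real.le_sqrt_of_sq_le (by nlinarith [sq_nonneg x])
      simp only [farPiece]
      have e : (141*T+1)*(x+4/5*y-1) ≤ (141*T+1)*(2*√(x^2+y^2)) := by gcongr; linarith
      nlinarith [mul_nonneg hT0.le h0, mul_nonneg hD0.le h0, mul_nonneg hTη.le h0]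

theorem eventually_pos_right_of_hasDerivAt {f : ℝ → ℝ} {f' t : ℝ} (hf : HasDerivAt f f' t)
    (h0 : 0 ≤ f t) (hf' : 0 < f') : ∀ᶠ u in nhdsWithin t (Set.Ioi t), 0 < f u := by
  have h := (hasDerivWithinAt_iff_tendsto_slope' (s := Set.Ioi t) (by simp)).1
    hf.hasDerivWithinAt
  filter_upwards [h.eventually (lt_mem_nhds hf'), self_mem_nhdsWithin] with u hu htu
  have htu : 0 < u - t := sub_pos.2 htu
  rw [slope_def_field] at hu
  have := (div_pos_iff_of_pos_right htu).1 hu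
  linarith

/-- An upper barrier along a trajectory in the phase domain, propagated forward in time from a
strict differential inequality for the active pieces. -/
theorem IsBarrier.le_of_hasDerivAt {P : Set Piece} {C c : ℝ} (hP : IsBarrier P C c)
    {s₀ s : ℝ} {x y x' y' X X' : ℝ → ℝ}
    (hdom : ∀ t ∈ Set.Icc s₀ s, (x t, y t) ∈ phaseDomain)
    (hx : ∀ t ∈ Set.Icc s₀ s, HasDerivAt x (x' t) t)
    (hy : ∀ t ∈ Set.Icc s₀ s, HasDerivAt y (y' t) t)
    (hX : ∀ t ∈ Set.Icc s₀ s, HasDerivAt X (X' t) t)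
    (hpos : ∀ t ∈ Set.Icc s₀ s, 0 < X t)
    (hinit : C * √(x s₀ ^ 2 + y s₀ ^ 2) ≤ X s₀)
    (hstrict : ∀ t ∈ Set.Icc s₀ s, ∀ p ∈ P, p.guard (x t) (y t) < 0 →
      p.value (x t) (y t) = X t →
      (∀ q ∈ P, q.guard (x t) (y t) < 0 → q.value (x t) (y t) ≤ X t) →
      p.dX (x t) (y t) * x' t + p.dY (x t) (y t) * y' t < X' t) :
    ∀ t ∈ Set.Icc s₀ s, ∀ p ∈ P, p.guard (x t) (y t) < 0 → p.value (x t) (y t) ≤ X t := by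
  have hopen : IsOpen phaseDomain := by
    unfold phaseDomain
    exact (isOpen_lt continuous_const continuous_fst).inter
      (isOpen_lt continuous_const continuous_snd)
  have hz : ∀ t ∈ Set.Icc s₀ s, ContinuousAt (fun u => (x u, y u)) t := fun t ht =>
    (hx t ht).continuousAt.prodMk (hy t ht).continuousAt
  have hg : ∀ p ∈ P, ∀ t ∈ Set.Icc s₀ s, ContinuousAt (fun u => p.guard (x u) (y u)) t :=
    fun p hp t ht => ContinuousAt.comp (f := fun u => (x u, y u))
      (g := fun z : ℝ × ℝ => p.guard z.1 z.2)
      ((hP.guard_cont p hp).continuousAt (hopen.mem_nhds (hdom t ht))) (hz t ht)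
  have hv : ∀ p ∈ P, ∀ t ∈ Set.Icc s₀ s, ContinuousAt (fun u => p.value (x u) (y u)) t :=
    fun p hp t ht => ContinuousAt.comp (f := fun u => (x u, y u))
      (g := fun z : ℝ × ℝ => p.value z.1 z.2)
      ((hP.value_cont p hp).continuousAt (hopen.mem_nhds (hdom t ht))) (hz t ht)
  let S : Set ℝ := {t | ∀ p ∈ P, 0 ≤ max (p.guard (x t) (y t)) (X t - p.value (x t) (y t))}
  have hS : ∀ t, t ∈ S ↔
      ∀ p ∈ P, p.guard (x t) (y t) < 0 → p.value (x t) (y t) ≤ X t := by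
    intro t
    simp only [S, Set.mem_ofPred_eq, le_max_iff, sub_nonneg]
    exact forall₂_congr fun p _ => by rw [← not_lt, or_iff_not_imp_left, not_not]
  suffices h : Set.Icc s₀ s ⊆ S from fun t ht => (hS t).1 (h ht)
  rcases lt_or_ge s s₀ with hs | hs
  · simp [Set.Icc_eq_empty_of_lt hs]
  refine IsClosed.Icc_subset_of_forall_exists_gt ?_ ?_ ?_
  · have : S ∩ Set.Icc s₀ s = Set.Icc s₀ s ∩ ⋂ p ∈ P, (Set.Icc s₀ s ∩
        (fun t => max (p.guard (x t) (y t)) (X t - p.value (x t) (y t))) ⁻¹' Set.Ici 0) := by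
      ext t
      simp only [S, Set.mem_inter_iff, Set.mem_ofPred_eq, Set.mem_iInter, Set.mem_preimage,
        Set.mem_Ici]
      exact ⟨fun h => ⟨h.2, fun i hi => ⟨h.2, h.1 i hi⟩⟩, fun h => ⟨fun i hi => (h.2 i hi).2, h.1⟩⟩
    rw [this]
    refine isClosed_Icc.inter (isClosed_biInter fun p hp => ?_)
    refine ContinuousOn.preimage_isClosed_of_isClosed (fun t ht => ?_) isClosed_Icc isClosed_Ici
    exact ContinuousAt.continuousWithinAt
      ((hg p hp t ht).max ((hX t ht).continuousAt.sub (hv p hp t ht)))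
  · have h0 : s₀ ∈ Set.Icc s₀ s := ⟨le_rfl, hs⟩
    exact (hS s₀).2 fun p hp hpg =>
      (hP.upper p hp _ _ (hdom s₀ h0).1 (hdom s₀ h0).2 hpg).trans hinit
  · rintro t ⟨htS, ht⟩ r hr
    have ht' : t ∈ Set.Icc s₀ s := ⟨ht.1, ht.2.le⟩
    have htS := (hS t).1 htS
    have hd : ∀ᶠ u in nhdsWithin t (Set.Ioi t), (x u, y u) ∈ phaseDomain :=
      nhdsWithin_le_nhds ((hz t ht').eventually (hopen.mem_nhds (hdom t ht')))
    have key : ∀ p ∈ P, ∀ᶠ u in nhdsWithin t (Set.Ioi t),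
        p.guard (x u) (y u) < 0 → p.value (x u) (y u) ≤ X u := by
      intro p hp
      rcases le_or_gt 0 (p.guard (x t) (y t)) with hpg | hpg
      · obtain ⟨q, hq, hqg, m, hm, hle⟩ := hP.dominated p hp _ _ (hdom t ht').1 (hdom t ht').2 hpg
        have hmX : m < X t := hm.trans_le (htS q hq hqg)
        filter_upwards [hd, nhdsWithin_le_nhds
          ((hX t ht').continuousAt.eventually (lt_mem_nhds hmX))] with u hu hmu hug
        exact (hle _ _ hu.1 hu.2 hug).trans (le_of_lt hmu)
      rcases (htS p hp hpg).lt_or_eq with hlt | heq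
      · filter_upwards [nhdsWithin_le_nhds (((hX t ht').continuousAt.sub
          (hv p hp t ht')).eventually (lt_mem_nhds (sub_pos.2 hlt)))] with u hu _
        exact (sub_pos.1 hu).le
      · have hne : x t ≠ 0 ∨ y t ≠ 0 := by
          by_contra! h
          have h1 := hP.upper p hp _ _ (hdom t ht').1 (hdom t ht').2 hpg
          have h2 := hpos t ht'
          rw [heq] at h1
          simp only [h.1, h.2] at h1
          norm_num at h1
          linarith
        have hder := (hX t ht').sub
          (hP.hasDerivAt p hp x y _ _ t (hx t ht') (hy t ht') (hdom t ht').1 hne)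
        filter_upwards [eventually_pos_right_of_hasDerivAt hder (by simp [heq])
          (sub_pos.2 (hstrict t ht' p hp hpg heq htS))] with u hu _
        exact (sub_pos.1 hu).le
    have := (Filter.eventually_all_finite hP.finite).2 key
    obtain ⟨u, hu, hur⟩ := (this.and (Ioc_mem_nhdsGT hr)).exists
    exact ⟨u, (hS u).2 hu, hur⟩

/-- Trajectories of the perturbed planar system are controlled by the initial datum and the
forcing, with exponential rate `1/4`. -/
theorem exists_control : ∃ K : ℝ, 0 < K ∧ ∀ (U : Set ℝ) (s₀ s : ℝ) (x y L a b w : ℝ → ℝ),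
    IsOpen U → s₀ ≤ s → Set.Icc s₀ s ⊆ U →
    ContinuousOn a U → ContinuousOn b U →
    (∀ t ∈ U, -2 < x t ∧ -1 < y t) →
    (∀ t ∈ U, HasDerivAt x (fieldX (x t) (y t) - L t / 2 * x t + a t) t) →
    (∀ t ∈ U, HasDerivAt y (fieldY (x t) (y t) - L t / 2 * y t + b t) t) →
    (∀ t ∈ U, |L t| ≤ |a t|) → (∀ t ∈ U, 0 < w t) →
    (∀ t ∈ U, HasDerivAt w (L t / 2 * w t) t) →
    √(x s ^ 2 + y s ^ 2) ≤ K * (exp ((s₀ - s) / 4) * (w s₀ / w s) * √(x s₀ ^ 2 + y s₀ ^ 2)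
      + ∫ τ in s₀..s, exp ((τ - s) / 4) * (w τ / w s) * √(a τ ^ 2 + b τ ^ 2)) := by
  obtain ⟨P, C, c, hP⟩ := exists_isBarrier
  have hC := hP.pos_C
  have hc := hP.pos_c
  refine ⟨3 * C / c, by positivity, ?_⟩
  intro U s₀ s x y L a b w hU hs hsub ha hb hdom hx hy hL hw hw'
  set n : ℝ → ℝ := fun t => √(a t ^ 2 + b t ^ 2) with hn
  set W : ℝ → ℝ := fun t => w t * exp (t / 4) with hWdef
  have hWpos : ∀ t ∈ U, 0 < W t := fun t ht => mul_pos (hw t ht) (exp_pos _)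
  have hWder : ∀ t ∈ U, HasDerivAt W ((L t / 2 + 1 / 4) * W t) t := by
    intro t ht
    have := (hw' t ht).mul ((hasDerivAt_id t).div_const 4).exp
    refine HasDerivAt.congr_deriv (f := W) this ?_
    simp only [hWdef, id]
    ring
  have hncont : ContinuousOn n U := by
    apply Real.continuous_sqrt.comp_continuousOn
    exact (ha.pow 2).add (hb.pow 2)
  have hWn : ContinuousOn (fun t => W t * n t) U :=
    ContinuousOn.mul (fun t ht => (hWder t ht).continuousAt.continuousWithinAt) hncont
  have hWn' : ∀ t ∈ U, ContinuousAt (fun t => W t * n t) t := fun t ht =>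
    hWn.continuousAt (hU.mem_nhds ht)
  set M : ℝ → ℝ := fun t => ∫ τ in s₀..t, W τ * n τ with hM
  have hMder : ∀ t ∈ Set.Icc s₀ s, HasDerivAt M (W t * n t) t := by
    intro t ht
    refine integral_hasDerivAt_right ?_
      (ContinuousAt.stronglyMeasurableAtFilter hU hWn' t (hsub ht)) (hWn' t (hsub ht))
    refine (hWn.mono ?_).intervalIntegrable
    rw [Set.uIcc_of_le ht.1]
    exact (Set.Icc_subset_Icc_right ht.2).trans hsub
  have hMnn : ∀ t ∈ Set.Icc s₀ s, 0 ≤ M t := by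
    intro t ht
    refine integral_nonneg ht.1 fun u hu => ?_
    exact mul_nonneg (hWpos u (hsub ⟨hu.1, hu.2.trans ht.2⟩)).le (sqrt_nonneg _)
  have h0 : s₀ ∈ Set.Icc s₀ s := ⟨le_rfl, hs⟩
  have h1 : s ∈ Set.Icc s₀ s := ⟨hs, le_rfl⟩
  have main : ∀ ε > 0, c * √(x s ^ 2 + y s ^ 2) * W s ≤
      C * √(x s₀ ^ 2 + y s₀ ^ 2) * W s₀ + 3 * C * M s + ε * (1 + (s - s₀)) := by
    intro ε hε
    set X : ℝ → ℝ := fun t => (C * √(x s₀ ^ 2 + y s₀ ^ 2) * W s₀ + 3 * C * M t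
      + ε * (1 + (t - s₀))) / W t with hX
    have hle := hP.le_of_hasDerivAt (X := X) (x := x) (y := y)
      (X' := fun t => -(L t / 2 + 1 / 4) * X t + 3 * C * n t + ε / W t)
      (fun t ht => hdom t (hsub ht)) (fun t ht => hx t (hsub ht)) (fun t ht => hy t (hsub ht))
      ?_ ?_ ?_ ?_ s h1
    · obtain ⟨p, hp, hpg, hlow⟩ := hP.lower _ _ (hdom s (hsub h1)).1 (hdom s (hsub h1)).2
      have := hlow.trans (hle p hp hpg)
      exact (le_div_iff₀ (hWpos s (hsub h1))).1 this
    · intro t ht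
      have hWt := (hWpos t (hsub ht)).ne'
      have := (((hMder t ht).const_mul (3 * C)).const_add
        (C * √(x s₀ ^ 2 + y s₀ ^ 2) * W s₀)).add
        ((((hasDerivAt_id t).sub_const s₀).const_add 1).const_mul ε)
      have := this.div (hWder t (hsub ht)) hWt
      refine HasDerivAt.congr_deriv (f := X) this ?_
      simp only [hX, Pi.add_apply, id]
      field_simp
      ring
    · intro t ht
      refine div_pos ?_ (hWpos t (hsub ht))
      have h2 := hWpos s₀ (hsub h0)
      have h3 := hMnn t ht
      have h4 : 0 ≤ t - s₀ := sub_nonneg.2 ht.1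
      positivity
    · have hM0 : M s₀ = 0 := by simp [hM]
      rw [hX]
      simp only [hM0]
      rw [le_div_iff₀ (hWpos s₀ (hsub h0))]
      nlinarith
    · intro t ht p hp hpg heq hall
      have htU := hsub ht
      obtain ⟨hdec, hdX, hdY, hhom⟩ := hP.active p hp _ _ (hdom t htU).1 (hdom t htU).2 hpg
        (heq ▸ (by
          refine div_pos ?_ (hWpos t htU)
          have h2 := hWpos s₀ (hsub h0)
          have h3 := hMnn t ht
          have h4 : 0 ≤ t - s₀ := sub_nonneg.2 ht.1
          positivity)) (by rwa [heq])
      have hεW : 0 < ε / W t := div_pos hε (hWpos t htU)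
      have hna : |a t| ≤ n t := abs_le_sqrt (by nlinarith [sq_nonneg (b t)])
      have hnb : |b t| ≤ n t := abs_le_sqrt (by nlinarith [sq_nonneg (a t)])
      have hLa := (hL t htU).trans hna
      have e1 : p.dX (x t) (y t) * a t ≤ C * n t :=
        (le_abs_self _).trans (by rw [abs_mul]; gcongr)
      have e2 : p.dY (x t) (y t) * b t ≤ C * n t :=
        (le_abs_self _).trans (by rw [abs_mul]; gcongr)
      have e3 : (p.value (x t) (y t) - (p.dX (x t) (y t) * x t + p.dY (x t) (y t) * y t)) * L t
          ≤ C * n t := (le_abs_self _).trans (by rw [abs_mul]; gcongr)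
      have hn0 : 0 ≤ C * n t := mul_nonneg hC.le (sqrt_nonneg _)
      rw [← heq]
      nlinarith
  have hlim : c * √(x s ^ 2 + y s ^ 2) * W s ≤
      C * √(x s₀ ^ 2 + y s₀ ^ 2) * W s₀ + 3 * C * M s := by
    refine le_of_forall_pos_le_add fun ε hε => ?_
    have h2 : 0 < 1 + (s - s₀) := by linarith
    have := main (ε / (1 + (s - s₀))) (by positivity)
    rwa [div_mul_cancel₀ _ h2.ne'] at this
  have hWs := hWpos s (hsub h1)
  have hWs₀ := hWpos s₀ (hsub h0)
  have hws := hw s (hsub h1)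
  have hint : ∫ τ in s₀..s, exp ((τ - s) / 4) * (w τ / w s) * √(a τ ^ 2 + b τ ^ 2)
      = M s / W s := by
    rw [hM]
    simp only []
    rw [← intervalIntegral.integral_div]
    refine integral_congr fun τ _ => ?_
    simp only [hWdef, hn, sub_div, exp_sub]
    field_simp
  have hfst : exp ((s₀ - s) / 4) * (w s₀ / w s) = W s₀ / W s := by
    simp only [hWdef, sub_div, exp_sub]
    field_simp
  rw [hint, hfst]
  have : √(x s ^ 2 + y s ^ 2) ≤
      (3 * C * √(x s₀ ^ 2 + y s₀ ^ 2) * W s₀ + 3 * C * M s) / (c * W s) := by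
    rw [le_div_iff₀ (by positivity)]
    have : 0 ≤ C * √(x s₀ ^ 2 + y s₀ ^ 2) * W s₀ := by positivity
    nlinarith
  refine this.trans_eq ?_
  field_simp

theorem ContDiff.hasDerivAt_fst {f : ℝ → ℝ → ℝ} {n : WithTop ℕ∞} (hn : n ≠ 0)
    (hf : ContDiff ℝ n (Function.uncurry f)) (τ θ : ℝ) :
    HasDerivAt (fun s => f s θ) (fderiv ℝ (Function.uncurry f) (τ, θ) (1, 0)) τ :=
  (((hf.differentiable hn) (τ, θ)).hasFDerivAt.comp_hasDerivAt τ
    ((hasDerivAt_id τ).prodMk (hasDerivAt_const τ θ)) :)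

theorem ContDiff.hasDerivAt_snd {f : ℝ → ℝ → ℝ} {n : WithTop ℕ∞} (hn : n ≠ 0)
    (hf : ContDiff ℝ n (Function.uncurry f)) (τ θ : ℝ) :
    HasDerivAt (fun s => f τ s) (fderiv ℝ (Function.uncurry f) (τ, θ) (0, 1)) θ :=
  (((hf.differentiable hn) (τ, θ)).hasFDerivAt.comp_hasDerivAt θ
    ((hasDerivAt_const θ τ).prodMk (hasDerivAt_id θ)) :)

theorem ContDiff.deriv_fst {f : ℝ → ℝ → ℝ} {m n : WithTop ℕ∞} (hmn : m + 1 ≤ n)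
    (hf : ContDiff ℝ n (Function.uncurry f)) :
    ContDiff ℝ m (fun z : ℝ × ℝ => deriv (fun s => f s z.2) z.1) := by
  have hn : n ≠ 0 := fun h => by rw [h] at hmn; simp at hmn
  simp_rw [fun z : ℝ × ℝ => (hf.hasDerivAt_fst hn z.1 z.2).deriv]
  exact (hf.fderiv_right hmn).clm_apply contDiff_const

theorem ContDiff.deriv_snd {f : ℝ → ℝ → ℝ} {m n : WithTop ℕ∞} (hmn : m + 1 ≤ n)
    (hf : ContDiff ℝ n (Function.uncurry f)) :
    ContDiff ℝ m (fun z : ℝ × ℝ => deriv (fun s => f z.1 s) z.2) := by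
  have hn : n ≠ 0 := fun h => by rw [h] at hmn; simp at hmn
  simp_rw [fun z : ℝ × ℝ => (hf.hasDerivAt_snd hn z.1 z.2).deriv]
  exact (hf.fderiv_right hmn).clm_apply contDiff_const

/-- Differentiation under the integral sign for a jointly `C¹` integrand. -/
theorem ContDiff.hasDerivAt_intervalIntegral {f : ℝ → ℝ → ℝ}
    (hf : ContDiff ℝ 1 (Function.uncurry f)) (a b τ : ℝ) :
    HasDerivAt (fun t => ∫ θ in a..b, f t θ) (∫ θ in a..b, deriv (fun s => f s θ) τ) τ := by
  have hd : Continuous (fun z : ℝ × ℝ => deriv (fun s => f s z.2) z.1) :=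
    (hf.deriv_fst (m := 0) (by simp)).continuous
  obtain ⟨M, hM⟩ := ((isCompact_Icc (a := τ - 1) (b := τ + 1)).prod
    (isCompact_uIcc (a := a) (b := b))).exists_bound_of_continuousOn hd.continuousOn
  have hc : ∀ t, Continuous (f t) := fun t => hf.continuous.comp (by fun_prop : Continuous (t, ·))
  refine (hasDerivAt_integral_of_dominated_loc_of_deriv_le (bound := fun _ => M)
    (F' := fun t θ => deriv (fun s => f s θ) t)
    (Icc_mem_nhds (by linarith : τ - 1 < τ) (by linarith : τ < τ + 1))
    (.of_forall fun t => (hc t).aestronglyMeasurable) ((hc τ).intervalIntegrable _ _)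
    (hd.comp (by fun_prop : Continuous (τ, ·))).aestronglyMeasurable
    (.of_forall fun θ hθ t ht => hM (t, θ) ⟨ht, Set.uIoc_subset_uIcc hθ⟩)
    intervalIntegrable_const
    (.of_forall fun θ _ t _ => ?_)).2
  exact (hf.hasDerivAt_fst one_ne_zero t θ).differentiableAt.hasDerivAt

theorem Continuous.intervalIntegral_fst {f : ℝ → ℝ → ℝ}
    (hf : Continuous (fun z : ℝ × ℝ => f z.1 z.2)) (a b : ℝ) :
    Continuous (fun t => ∫ θ in a..b, f t θ) :=
  continuous_parametric_intervalIntegral_of_continuous' hf a b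

theorem ContDiff.intervalIntegral_fst {f : ℝ → ℝ → ℝ}
    (hf : ContDiff ℝ 1 (Function.uncurry f)) (a b : ℝ) :
    ContDiff ℝ 1 (fun t => ∫ θ in a..b, f t θ) := by
  refine contDiff_one_iff_deriv.2
    ⟨fun t => (hf.hasDerivAt_intervalIntegral a b t).differentiableAt, ?_⟩
  rw [funext fun t => (hf.hasDerivAt_intervalIntegral a b t).deriv]
  exact Continuous.intervalIntegral_fst (hf.deriv_fst (m := 0) (by simp)).continuous a b

namespace T2Flow

variable (F : T2Flow)

theorem contDiff_V : ContDiff ℝ (⊤ : ℕ∞) (fun z : ℝ × ℝ => F.V z.1 z.2) := F.smooth_V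

theorem contDiff_ρ : ContDiff ℝ (⊤ : ℕ∞) (fun z : ℝ × ℝ => F.ρ z.1 z.2) := F.smooth_ρ

theorem contDiff_l : ContDiff ℝ (⊤ : ℕ∞) (fun z : ℝ × ℝ => F.l z.1 z.2) := F.smooth_l

theorem contDiff_Vτ : ContDiff ℝ (⊤ : ℕ∞) (fun z : ℝ × ℝ => F.Vτ z.1 z.2) :=
  F.smooth_V.deriv_fst (by simp)

theorem contDiff_J : ContDiff ℝ (⊤ : ℕ∞) (fun z : ℝ × ℝ => F.J z.1 z.2) := by
  have h1 := F.contDiff_V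
  have h2 := F.contDiff_ρ
  have h3 := F.contDiff_Vτ
  have h4 : ContDiff ℝ (⊤ : ℕ∞) (fun z : ℝ × ℝ => F.Vθ z.1 z.2) :=
    F.smooth_V.deriv_snd (by simp)
  have h5 : ContDiff ℝ (⊤ : ℕ∞) (fun z : ℝ × ℝ => F.Qτ z.1 z.2) :=
    F.smooth_Q.deriv_fst (by simp)
  have h6 : ContDiff ℝ (⊤ : ℕ∞) (fun z : ℝ × ℝ => F.Qθ z.1 z.2) :=
    F.smooth_Q.deriv_snd (by simp)
  unfold J
  fun_prop

theorem contDiff_exp_ρ : ContDiff ℝ 1 (Function.uncurry fun τ θ => exp (F.ρ τ θ)) :=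
  (F.contDiff_ρ.of_le (by simp)).exp

theorem contDiff_exp_Y :
    ContDiff ℝ 1 (Function.uncurry fun τ θ => exp (F.l τ θ + F.ρ τ θ + 2 * τ)) := by
  have h1 := F.contDiff_ρ.of_le (m := 1) (by simp)
  have h2 := F.contDiff_l.of_le (m := 1) (by simp)
  unfold Function.uncurry
  fun_prop

theorem contDiff_E : ContDiff ℝ 1 F.E := by
  have h1 := F.contDiff_ρ.of_le (m := 1) (by simp)
  have h2 := F.contDiff_J.of_le (m := 1) (by simp)
  refine ContDiff.intervalIntegral_fst ?_ 0 1
  unfold Function.uncurry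
  fun_prop

theorem contDiff_Pi : ContDiff ℝ 1 F.Pi :=
  F.contDiff_exp_ρ.intervalIntegral_fst 0 1

theorem contDiff_Λ : ContDiff ℝ 1 F.Λ := by
  have h1 := F.contDiff_ρ.of_le (m := 1) (by simp)
  have h2 := F.contDiff_V.of_le (m := 1) (by simp)
  have h3 := F.contDiff_Vτ.of_le (m := 1) (by simp)
  have h4 : ContDiff ℝ 1 (fun τ => circleMean (F.V τ)) :=
    ContDiff.intervalIntegral_fst (f := F.V) h2 0 1
  have h5 : ContDiff ℝ 1 (fun τ => ∫ θ in (0:ℝ)..1,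
      F.Vτ τ θ * (F.V τ θ - circleMean (F.V τ) - 1) * exp (F.ρ τ θ)) := by
    refine ContDiff.intervalIntegral_fst ?_ 0 1
    have h6 : ContDiff ℝ 1 (fun z : ℝ × ℝ => circleMean (F.V z.1)) := h4.comp contDiff_fst
    exact (h3.mul ((h2.sub h6).sub contDiff_const)).mul h1.exp
  unfold Λ
  fun_prop

theorem contDiff_H : ContDiff ℝ 1 F.H :=
  F.contDiff_Pi.mul (F.contDiff_E.add F.contDiff_Λ)

theorem contDiff_Y : ContDiff ℝ 1 F.Y :=
  F.contDiff_exp_Y.intervalIntegral_fst 0 1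

theorem Pi_pos (τ : ℝ) : 0 < F.Pi τ := by
  refine intervalIntegral_pos_of_pos ?_ (fun _ => exp_pos _) one_pos
  exact (F.contDiff_exp_ρ.continuous.comp
    (by fun_prop : Continuous fun θ : ℝ => (τ, θ))).intervalIntegrable _ _

theorem Y_pos (τ : ℝ) : 0 < F.Y τ := by
  refine intervalIntegral_pos_of_pos ?_ (fun _ => exp_pos _) one_pos
  exact (F.contDiff_exp_Y.continuous.comp
    (by fun_prop : Continuous fun θ : ℝ => (τ, θ))).intervalIntegrable _ _

theorem continuous_Ω : Continuous F.Ω := by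
  have h1 := F.contDiff_E.continuous
  have h2 := F.contDiff_Y.continuous
  have h3 := F.contDiff_Pi.continuous
  have h4 : Continuous (fun τ => ∫ θ in (0:ℝ)..1,
      exp (F.l τ θ + F.ρ τ θ + 2 * τ) * F.J τ θ) :=
    Continuous.intervalIntegral_fst (F.contDiff_exp_Y.continuous.mul F.contDiff_J.continuous) 0 1
  unfold Ω
  exact h4.sub (Continuous.div (by fun_prop) h3 fun τ => (F.Pi_pos τ).ne')

variable {F}

theorem IsEinsteinFlow.hasDerivAt_Pi (hF : F.IsEinsteinFlow) (τ : ℝ) :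
    HasDerivAt F.Pi (exp (-2 * τ) * F.Y τ) τ := by
  refine (F.contDiff_exp_ρ.hasDerivAt_intervalIntegral 0 1 τ).congr_deriv ?_
  rw [Y, ← intervalIntegral.integral_const_mul]
  refine integral_congr fun θ _ => ?_
  have h := ((F.smooth_ρ.hasDerivAt_fst (by simp) τ θ).differentiableAt.hasDerivAt).exp.deriv
  have h' := hF.2.2.2.1 τ θ
  unfold ρτ at h'
  simp only [h, h', ← exp_add]
  ring_nf

theorem IsEinsteinFlow.hasDerivAt_Y (hF : F.IsEinsteinFlow) (τ : ℝ) :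
    HasDerivAt F.Y (F.Ω τ + exp (2 * τ) * F.E τ * F.Y τ / F.Pi τ) τ := by
  refine (F.contDiff_exp_Y.hasDerivAt_intervalIntegral 0 1 τ).congr_deriv ?_
  rw [Ω, sub_add_cancel]
  refine integral_congr fun θ _ => ?_
  have hρ := (F.smooth_ρ.hasDerivAt_fst (by simp) τ θ).differentiableAt.hasDerivAt
  have hl := (F.smooth_l.hasDerivAt_fst (by simp) τ θ).differentiableAt.hasDerivAt
  have h := ((hl.add hρ).add ((hasDerivAt_id τ).const_mul 2)).exp.deriv
  refine h.trans ?_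
  rw [← hF.2.2.1 τ θ, lτ, ρτ]
  simp

end T2Flow

namespace T2Flow

variable {F : T2Flow} {τ : ℝ}

theorem hasDerivAt_log_exp_mul_H (hτ : 0 < F.H τ) :
    HasDerivAt (fun s => log (exp s * F.H s)) (1 + deriv F.H τ / F.H τ) τ := by
  have h := ((Real.hasDerivAt_exp τ).mul
    (F.contDiff_H.differentiable one_ne_zero τ).hasDerivAt).log
      (by simp only [Pi.mul_apply]; positivity)
  refine h.congr_deriv ?_
  simp only [Pi.mul_apply]
  field_simp

theorem hasDerivAt_sqrt_exp_mul_H (hτ : 0 < F.H τ) :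
    HasDerivAt (fun s => √(exp s * F.H s))
      (deriv (fun s => log (exp s * F.H s)) τ / 2 * √(exp τ * F.H τ)) τ := by
  have h := ((Real.hasDerivAt_exp τ).mul
    (F.contDiff_H.differentiable one_ne_zero τ).hasDerivAt).sqrt
      (by simp only [Pi.mul_apply]; positivity)
  refine h.congr_deriv ?_
  rw [(hasDerivAt_log_exp_mul_H hτ).deriv]
  have h0 : 0 < exp τ * F.H τ := by positivity
  have h1 : √(exp τ * F.H τ) ^ 2 = exp τ * F.H τ := sq_sqrt h0.le
  have h2 : √(exp τ * F.H τ) ≠ 0 := (sqrt_pos.2 h0).ne'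
  simp only [Pi.mul_apply]
  field_simp
  rw [h1]
  ring

theorem exp_mul_sqrt_H (τ : ℝ) (k : ℝ) :
    exp ((k + 1 / 2) * τ) * √(F.H τ) = exp (k * τ) * √(exp τ * F.H τ) := by
  have h : exp τ = exp (1 / 2 * τ) ^ 2 := by rw [← exp_nat_mul]; congr 1; push_cast; ring
  rw [sqrt_mul (exp_pos _).le, h, sqrt_sq (exp_pos _).le, ← mul_assoc, ← exp_add]
  congr 2; ring

theorem c_add (τ : ℝ) :
    F.c τ + 2 / √10 = exp (-(1 / 2) * τ) * F.Pi τ / √(exp τ * F.H τ) := by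
  have h := exp_mul_sqrt_H (F := F) τ (1 / 2)
  rw [c, sub_add_cancel, show exp τ = exp ((1 / 2 + 1 / 2) * τ) by ring_nf, h,
    show -(1 / 2) * τ = -(1 / 2 * τ) by ring, exp_neg]
  field_simp
  ring_nf

theorem d_add (τ : ℝ) :
    F.d τ + 1 / √10 = exp (-(5 / 2) * τ) * F.Y τ / √(exp τ * F.H τ) := by
  have h := exp_mul_sqrt_H (F := F) τ (5 / 2)
  rw [d, sub_add_cancel, show exp (3 * τ) = exp ((5 / 2 + 1 / 2) * τ) by ring_nf, h,
    show -(5 / 2) * τ = -(5 / 2 * τ) by ring, exp_neg]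
  field_simp

theorem IsEinsteinFlow.hasDerivAt_c (hF : F.IsEinsteinFlow) (hτ : 0 < F.H τ) :
    HasDerivAt F.c (-F.c τ / 2 + F.d τ
      - deriv (fun s => log (exp s * F.H s)) τ / 2 * F.c τ + (F.Ωtilde τ).1) τ := by
  have h0 : 0 < √(exp τ * F.H τ) := by positivity
  have he : HasDerivAt (fun s => exp (-(1 / 2) * s)) (-(1 / 2) * exp (-(1 / 2) * τ)) τ := by
    refine ((hasDerivAt_id τ).const_mul (-(1 / 2))).exp.congr_deriv ?_
    simp only [id]
    ring
  have h := ((he.mul (hF.hasDerivAt_Pi τ)).div (hasDerivAt_sqrt_exp_mul_H hτ) h0.ne').sub_const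
    (2 / √10)
  simp only [Pi.mul_apply] at h
  have hc : F.c = fun s => exp (-(1 / 2) * s) * F.Pi s / √(exp s * F.H s) - 2 / √10 :=
    funext fun s => by rw [← c_add]; ring
  have hc' := c_add (F := F) τ
  have hd' := d_add (F := F) τ
  rw [hc]
  refine HasDerivAt.congr_deriv (f := fun s => exp (-(1 / 2) * s) * F.Pi s / √(exp s * F.H s)
    - 2 / √10) h ?_
  rw [← hc, Ωtilde]
  rw [show F.d τ = exp (-(5 / 2) * τ) * F.Y τ / √(exp τ * F.H τ) - 1 / √10 by linarith,
    show F.c τ = exp (-(1 / 2) * τ) * F.Pi τ / √(exp τ * F.H τ) - 2 / √10 by linarith,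
    show -(5 / 2) * τ = -(1 / 2) * τ + -2 * τ by ring, exp_add]
  field_simp
  ring

theorem IsEinsteinFlow.hasDerivAt_d (hF : F.IsEinsteinFlow) (hτ : 0 < F.H τ) :
    HasDerivAt F.d ((F.d τ + 1 / √10) / (F.c τ + 2 / √10) ^ 2 - 5 / 2 * (F.d τ + 1 / √10)
      - fquad (F.d τ) (F.c τ) / (F.c τ + 2 / √10) ^ 2
      - deriv (fun s => log (exp s * F.H s)) τ / 2 * F.d τ + (F.Ωtilde τ).2) τ := by
  have h0 : 0 < √(exp τ * F.H τ) := by positivity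
  have he : HasDerivAt (fun s => exp (-(5 / 2) * s)) (-(5 / 2) * exp (-(5 / 2) * τ)) τ := by
    refine ((hasDerivAt_id τ).const_mul (-(5 / 2))).exp.congr_deriv ?_
    simp only [id]
    ring
  have h := ((he.mul (hF.hasDerivAt_Y τ)).div (hasDerivAt_sqrt_exp_mul_H hτ) h0.ne').sub_const
    (1 / √10)
  simp only [Pi.mul_apply] at h
  have hd : F.d = fun s => exp (-(5 / 2) * s) * F.Y s / √(exp s * F.H s) - 1 / √10 :=
    funext fun s => by rw [← d_add]; ring
  have hc' := c_add (F := F) τ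
  have hd' := d_add (F := F) τ
  have hPi := F.Pi_pos τ
  have hquot : exp (2 * τ) * F.E τ / F.Pi τ
      = (F.Pi τ * F.E τ / F.H τ) / (F.c τ + 2 / √10) ^ 2 := by
    rw [hc', div_pow, sq_sqrt (by positivity), mul_pow, ← exp_nat_mul,
      show exp τ = exp (2 * τ) * exp (((2 : ℕ) : ℝ) * (-(1 / 2) * τ)) by
        rw [← exp_add]; congr 1; push_cast; ring]
    field_simp
  have hΩ : F.Ω τ / (exp (3 * τ) * √(F.H τ))
      = exp (-(5 / 2) * τ) * F.Ω τ / √(exp τ * F.H τ) := by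
    have h := exp_mul_sqrt_H (F := F) τ (5 / 2)
    rw [show exp (3 * τ) = exp ((5 / 2 + 1 / 2) * τ) by ring_nf, h,
      show -(5 / 2) * τ = -(5 / 2 * τ) by ring, exp_neg]
    field_simp
  have hY : exp (2 * τ) * F.E τ * F.Y τ / F.Pi τ = exp (2 * τ) * F.E τ / F.Pi τ * F.Y τ := by ring
  rw [hY, hquot] at h
  refine HasDerivAt.congr_deriv (f := F.d) (hd ▸ h) ?_
  rw [Ωtilde, hΩ]
  have hu : 0 < F.c τ + 2 / √10 := by rw [hc']; positivity
  generalize (F.c τ + 2 / √10) ^ 2 = u at *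
  generalize F.Pi τ * F.E τ / F.H τ = r at *
  rw [show F.d τ = exp (-(5 / 2) * τ) * F.Y τ / √(exp τ * F.H τ) - 1 / √10 by linarith]
  generalize fquad _ _ = q
  field_simp
  ring

end T2Flow

namespace T2Flow

variable {F : T2Flow} {τ : ℝ}

theorem sqrt_ten_mul_Ωtilde_fst :
    √10 * (F.Ωtilde τ).1 = -deriv (fun s => log (exp s * F.H s)) τ := by
  rw [Ωtilde]
  field_simp

theorem continuousOn_Ωtilde (hF : F.IsEinsteinFlow) :
    ContinuousOn (fun τ => (F.Ωtilde τ).1) {τ | 0 < F.H τ} ∧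
      ContinuousOn (fun τ => (F.Ωtilde τ).2) {τ | 0 < F.H τ} := by
  have hH : ContinuousOn F.H {τ | 0 < F.H τ} := F.contDiff_H.continuous.continuousOn
  have hE : ContinuousOn F.E {τ | 0 < F.H τ} := F.contDiff_E.continuous.continuousOn
  have hPi : ContinuousOn F.Pi {τ | 0 < F.H τ} := F.contDiff_Pi.continuous.continuousOn
  have hΩ : ContinuousOn F.Ω {τ | 0 < F.H τ} := F.continuous_Ω.continuousOn
  have hL : ContinuousOn (fun τ => deriv (fun s => log (exp s * F.H s)) τ) {τ | 0 < F.H τ} := by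
    have hH' : ContinuousOn (deriv F.H) {τ | 0 < F.H τ} :=
      (F.contDiff_H.continuous_deriv le_rfl).continuousOn
    refine ((continuousOn_const (c := (1 : ℝ))).add (hH'.div hH fun τ hτ => ne_of_gt hτ)).congr fun τ hτ => ?_
    exact (hasDerivAt_log_exp_mul_H hτ).deriv
  have hc : ContinuousOn F.c {τ | 0 < F.H τ} := fun τ hτ =>
    (hF.hasDerivAt_c hτ).continuousAt.continuousWithinAt
  have hd : ContinuousOn F.d {τ | 0 < F.H τ} := fun τ hτ =>
    (hF.hasDerivAt_d hτ).continuousAt.continuousWithinAt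
  have hu : ∀ τ ∈ {τ | 0 < F.H τ}, (F.c τ + 2 / √10) ^ 2 ≠ 0 := by
    intro τ hτ
    have hτ : 0 < F.H τ := hτ
    have hP := F.Pi_pos τ
    rw [c_add]
    positivity
  have hf : ContinuousOn (fun τ => fquad (F.d τ) (F.c τ)) {τ | 0 < F.H τ} := by
    unfold fquad
    fun_prop
  refine ⟨(hL.const_smul (-(1 / 2) : ℝ)).mul continuousOn_const,
    ((((hL.const_smul (-(1 / 2) : ℝ)).mul continuousOn_const).add (hf.div (by fun_prop) hu)).add
      (ContinuousOn.div ?_ (by fun_prop) hu)).add (hΩ.div (by fun_prop) fun τ hτ => ?_)⟩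
  · exact (((hPi.mul hE).div hH fun τ hτ => ne_of_gt hτ).sub continuousOn_const).mul (by fun_prop)
  · have hτ : 0 < F.H τ := hτ
    positivity

theorem mem_phaseDomain (hτ : 0 < F.H τ) : -2 < √10 * F.c τ ∧ -1 < √10 * F.d τ := by
  have hP := F.Pi_pos τ
  have hY := F.Y_pos τ
  have h1 : 0 < √10 * (F.c τ + 2 / √10) := by rw [c_add]; positivity
  have h2 : 0 < √10 * (F.d τ + 1 / √10) := by rw [d_add]; positivity
  rw [mul_add, mul_div_cancel₀ _ (by positivity)] at h1 h2
  constructor <;> linarith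

theorem sqrt_mul_sq_add_mul_sq (u v : ℝ) :
    √((√10 * u) ^ 2 + (√10 * v) ^ 2) = √10 * √(u ^ 2 + v ^ 2) := by
  rw [mul_pow, mul_pow, ← mul_add, sqrt_mul (by positivity), sqrt_sq (by positivity)]

theorem fieldY_eq (hτ : 0 < F.H τ) : √10 * ((F.d τ + 1 / √10) / (F.c τ + 2 / √10) ^ 2
      - 5 / 2 * (F.d τ + 1 / √10) - fquad (F.d τ) (F.c τ) / (F.c τ + 2 / √10) ^ 2)
    = fieldY (√10 * F.c τ) (√10 * F.d τ) := by
  have h1 := (mem_phaseDomain hτ).1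
  have h2 : √10 * F.c τ + 2 ≠ 0 := by linarith
  have h10 : √10 ≠ 0 := by positivity
  have hsq : √10 ^ 2 = 10 := sq_sqrt (by norm_num)
  have h3 : F.c τ + 2 / √10 = (√10 * F.c τ + 2) / √10 := by field_simp
  rw [h3, fieldY, fquad]
  generalize hx : √10 * F.c τ = x at *
  generalize hy : √10 * F.d τ = y at *
  have hc : F.c τ = x / √10 := by rw [← hx]; field_simp
  have hd : F.d τ = y / √10 := by rw [← hy]; field_simp
  rw [hc, hd]
  generalize √10 = r at *
  field_simp
  simp only [hsq]
  ring

end T2Flow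

/-- If `H > 0` on `[s₀, s]`, then the Euclidean norm of `(c,d)` satisfies
`|(c,d)|(s) ≲ e^{(s₀−s)/4}(e^{s₀}H(s₀)/(e^sH(s)))^{1/2}|(c,d)|(s₀)
  + ∫ e^{(τ−s)/4}(e^τH(τ)/(e^sH(s)))^{1/2}|Ω̃(τ)| dτ`. -/
theorem cd_estimate :
    ∃ C : ℝ, 0 < C ∧ ∀ (F : T2Flow), F.IsEinsteinFlow → (∀ τ : ℝ, F.B τ = 0) →
      ∀ s₀ s : ℝ, s₀ ≤ s → (∀ τ ∈ Set.Icc s₀ s, 0 < F.H τ) →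
        Real.sqrt (F.c s ^ 2 + F.d s ^ 2)
          ≤ C * (Real.exp ((s₀ - s)/4)
                  * Real.sqrt (Real.exp s₀ * F.H s₀ / (Real.exp s * F.H s))
                  * Real.sqrt (F.c s₀ ^ 2 + F.d s₀ ^ 2)
              + ∫ τ in s₀..s,
                  Real.exp ((τ - s)/4)
                    * Real.sqrt (Real.exp τ * F.H τ / (Real.exp s * F.H s))
                    * Real.sqrt ((F.Ωtilde τ).1 ^ 2 + (F.Ωtilde τ).2 ^ 2)) := by
  obtain ⟨K, hK, hcontrol⟩ := exists_control
  refine ⟨K, hK, fun F hF _ s₀ s hs hH => ?_⟩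
  have h10 : 0 < √10 := by positivity
  have h := hcontrol {τ | 0 < F.H τ} s₀ s (fun τ => √10 * F.c τ) (fun τ => √10 * F.d τ)
    (fun τ => deriv (fun s => log (exp s * F.H s)) τ)
    (fun τ => √10 * (F.Ωtilde τ).1) (fun τ => √10 * (F.Ωtilde τ).2)
    (fun τ => √(exp τ * F.H τ)) (isOpen_lt continuous_const F.contDiff_H.continuous) hs hH
    (continuousOn_const.mul (T2Flow.continuousOn_Ωtilde hF).1)
    (continuousOn_const.mul (T2Flow.continuousOn_Ωtilde hF).2)
    (fun τ hτ => T2Flow.mem_phaseDomain hτ)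
    (fun τ hτ => ((hF.hasDerivAt_c hτ).const_mul √10).congr_deriv (by rw [fieldX]; ring))
    (fun τ hτ => ((hF.hasDerivAt_d hτ).const_mul √10).congr_deriv
      (by rw [← T2Flow.fieldY_eq hτ]; ring))
    (fun τ _ => by rw [T2Flow.sqrt_ten_mul_Ωtilde_fst, abs_neg])
    (fun τ hτ => sqrt_pos.2 (mul_pos (exp_pos τ) hτ))
    (fun τ hτ => T2Flow.hasDerivAt_sqrt_exp_mul_H hτ)
  have hint : ∫ τ in s₀..s, exp ((τ - s) / 4) * (√(exp τ * F.H τ) / √(exp s * F.H s)) *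
        √((√10 * (F.Ωtilde τ).1) ^ 2 + (√10 * (F.Ωtilde τ).2) ^ 2)
      = √10 * ∫ τ in s₀..s, exp ((τ - s) / 4) * √(exp τ * F.H τ / (exp s * F.H s)) *
        √((F.Ωtilde τ).1 ^ 2 + (F.Ωtilde τ).2 ^ 2) := by
    rw [← intervalIntegral.integral_const_mul]
    refine integral_congr fun τ hτ => ?_
    rw [Set.uIcc_of_le hs] at hτ
    simp only [T2Flow.sqrt_mul_sq_add_mul_sq]
    rw [sqrt_div (mul_pos (exp_pos τ) (hH τ hτ)).le]
    ring
  rw [hint] at h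
  simp only [T2Flow.sqrt_mul_sq_add_mul_sq] at h
  rw [← sqrt_div (mul_pos (exp_pos s₀) (hH s₀ ⟨le_rfl, hs⟩)).le] at h
  refine le_of_mul_le_mul_left (h.trans_eq ?_) h10
  ring
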